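/- arXiv:1910.11409 — 2 statements merged into one kernel-verified Lean document; each statement's English description precedes it below -/
import Mathlib

section
/- Let d ≥ 3 be an integer and let p > d/(d-1) with p ≤ 2. Then the full minor-arc maximal operator is bounded on l^p(ℤ^d): there is a constant C = C(d,p) such that for every f ∈ l^p(ℤ^d), ‖ sup_{λ ∈ ℕ, λ ≥ 1} |E_{m,λ} f| ‖_{l^p(ℤ^d)} ≤ C ‖f‖_{l^p(ℤ^d)}, where for each λ the operator E_{m,λ} is taken at the dyadic scale Λ = 2^j with λ ∈ [2^j, 2^{j+1}) and N = Λ^{1/2}. -/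
open scoped ENNReal NNReal BigOperators Real
open MeasureTheory

noncomputable section

/-- `ℤ^d` -/
abbrev V (d : ℕ) := Fin d → ℤ

/-- The sphere `{(u,v) ∈ ℤ^d × ℤ^d : |u|² + |v|² = λ}`. -/
def sph (d lam : ℕ) : Set (V d × V d) :=
  {uv | (∑ i, uv.1 i ^ 2) + (∑ i, uv.2 i ^ 2) = (lam : ℤ)}

/-- `N(λ)`, the number of lattice points on the sphere of radius `λ^{1/2}` in `ℝ^{2d}`. -/
def Ncount (d lam : ℕ) : ℕ := Nat.card (sph d lam)

/-- `e(t) = e^{2πit}`. -/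
def eC (t : ℝ) : ℂ := Complex.exp (2 * Real.pi * Complex.I * t)

/-- The quadratic Weyl sum `S_N(θ,ξ) = Σ_{u ∈ ℤ, 0 ≤ u ≤ N} e(θu² + ξu)`. -/
def SN (N θ ξ : ℝ) : ℂ :=
  ∑ u ∈ Finset.range (⌊N⌋₊ + 1), eC (θ * (u : ℝ) ^ 2 + ξ * (u : ℝ))

/-- `F_N(θ,ξ) = Π_{i=1}^d S_N(θ,ξ_i)` for `ξ ∈ ℝ^d`. -/
def FN (d : ℕ) (N θ : ℝ) (ξ : Fin d → ℝ) : ℂ := ∏ i, SN N θ (ξ i)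

/-- `F_N(θ) = S_N(θ,0)^d`. -/
def FN0 (d : ℕ) (N θ : ℝ) : ℂ := SN N θ 0 ^ d

/-- The major arcs at scale `N`:
`M_N = ∪_{1 ≤ q ≤ N} ∪_{1 ≤ a ≤ q, (a,q)=1} {θ ∈ [0,1] : |θ - a/q| ≤ 1/(8qN)}`. -/
def majorArcs (N : ℝ) : Set ℝ :=
  ⋃ (q : ℕ) (_ : 1 ≤ q ∧ (q : ℝ) ≤ N) (a : ℕ) (_ : 1 ≤ a ∧ a ≤ q ∧ Nat.gcd a q = 1),
    {θ : ℝ | θ ∈ Set.Icc (0 : ℝ) 1 ∧ |θ - (a : ℝ) / q| ≤ 1 / (8 * q * N)}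

/-- The minor arcs `m_N = [0,1] \ M_N`. -/
def minorArcs (N : ℝ) : Set ℝ := Set.Icc (0 : ℝ) 1 \ majorArcs N

/-- The lattice box `ℤ^d ∩ [0,N]^d`. -/
def box (d : ℕ) (N : ℝ) : Finset (V d) :=
  Fintype.piFinset fun _ => Finset.Icc (0 : ℤ) ⌊N⌋

/-- The minor-arc error operator
`E_{m,λ} f(x) = N(λ)⁻¹ ∫_{m_N} Σ_{u,v ∈ ℤ^d ∩ [0,N]^d} e(θ(|u|² + |v|² - λ)) f(x-u) dθ`. -/
def Eminor (d lam : ℕ) (N : ℝ) (f : V d → ℂ) (x : V d) : ℂ :=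
  (Ncount d lam : ℂ)⁻¹ *
    ∫ θ in minorArcs N,
      ∑ u ∈ box d N, ∑ v ∈ box d N,
        eC (θ * (((∑ i, u i ^ 2) + (∑ i, v i ^ 2) - (lam : ℤ) : ℤ) : ℝ)) * f (x - u)

/-- The `l^p(ℤ^d)` norm of a complex-valued function. -/
def lpNorm (d : ℕ) (p : ℝ) (f : V d → ℂ) : ℝ≥0∞ :=
  (∑' x : V d, (‖f x‖₊ : ℝ≥0∞) ^ p) ^ (1 / p)

/-- The `l^p(ℤ^d)` norm of an `ℝ≥0∞`-valued function. -/
def lpNormE (d : ℕ) (p : ℝ) (F : V d → ℝ≥0∞) : ℝ≥0∞ :=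
  (∑' x : V d, F x ^ p) ^ (1 / p)

/-- The minor-arc error operator at the dyadic scale of `λ`: for `λ ∈ [2^j, 2^{j+1})` we take
`Λ = 2^j` (so `j = ⌊log₂ λ⌋`) and `N = Λ^{1/2}`. -/
def Efull (d lam : ℕ) (f : V d → ℂ) (x : V d) : ℂ :=
  Eminor d lam (Real.sqrt ((2 : ℝ) ^ Nat.log 2 lam)) f x

namespace MinorArc

section Quaternions

open Quaternion

/-- The integral quaternion with the given coordinates. -/
def quat (a b c e : ℤ) : ℍ[ℤ] := ⟨a, b, c, e⟩

@[simp] lemma quat_re (a b c e : ℤ) : (quat a b c e).re = a := rfl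
@[simp] lemma quat_imI (a b c e : ℤ) : (quat a b c e).imI = b := rfl
@[simp] lemma quat_imJ (a b c e : ℤ) : (quat a b c e).imJ = c := rfl
@[simp] lemma quat_imK (a b c e : ℤ) : (quat a b c e).imK = e := rfl

lemma finite_normSq (n : ℤ) : {v : ℍ[ℤ] | normSq v = n}.Finite := by
  have hinj : Function.Injective
      (fun v : ℍ[ℤ] => (v.re, v.imI, v.imJ, v.imK)) := by
    intro v w h
    simp only [Prod.mk.injEq] at h
    exact QuaternionAlgebra.ext h.1 h.2.1 h.2.2.1 h.2.2.2
  refine Set.Finite.of_finite_image (f := fun v : ℍ[ℤ] => (v.re, v.imI, v.imJ, v.imK))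
    (Set.Finite.subset ((Set.finite_Icc (-n) n).prod ((Set.finite_Icc (-n) n).prod
      ((Set.finite_Icc (-n) n).prod (Set.finite_Icc (-n) n)))) ?_) hinj.injOn
  rintro _ ⟨v, hv, rfl⟩
  simp only [Set.mem_ofPred_eq, normSq_def'] at hv
  have key : ∀ x : ℤ, x ^ 2 ≤ n → -n ≤ x ∧ x ≤ n := fun x hx => by
    constructor <;> nlinarith [Int.le_self_sq x, Int.le_self_sq (-x)]
  simp only [Set.mem_prod, Set.mem_Icc]
  refine ⟨key _ ?_, key _ ?_, key _ ?_, key _ ?_⟩ <;>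
    nlinarith [sq_nonneg v.re, sq_nonneg v.imI, sq_nonneg v.imJ, sq_nonneg v.imK]

lemma intCast_dvd_iff (m : ℤ) (v : ℍ[ℤ]) :
    (m : ℍ[ℤ]) ∣ v ↔ m ∣ v.re ∧ m ∣ v.imI ∧ m ∣ v.imJ ∧ m ∣ v.imK := by
  constructor
  · rintro ⟨w, rfl⟩
    simp
  · rintro ⟨⟨a, ha⟩, ⟨b, hb⟩, ⟨c, hc⟩, ⟨e, he⟩⟩
    exact ⟨quat a b c e, by ext <;> simp [ha, hb, hc, he]⟩

lemma intCast_dvd_mul_left {m : ℤ} {v : ℍ[ℤ]} (h : (m : ℍ[ℤ]) ∣ v) (w : ℍ[ℤ]) :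
    (m : ℍ[ℤ]) ∣ w * v := by
  obtain ⟨x, rfl⟩ := h
  exact ⟨w * x, by rw [← mul_assoc, ← mul_assoc, (Int.cast_commute m w).eq]⟩

lemma intCast_dvd_star {m : ℤ} {v : ℍ[ℤ]} (h : (m : ℍ[ℤ]) ∣ v) : (m : ℍ[ℤ]) ∣ star v := by
  rw [intCast_dvd_iff] at h ⊢
  simpa using h

lemma intCast_dvd_of_dvd_intCast_mul {p l : ℤ} (hpl : IsCoprime l p) {w : ℍ[ℤ]}
    (h : (l : ℍ[ℤ]) ∣ (p : ℍ[ℤ]) * w) : (l : ℍ[ℤ]) ∣ w := by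
  rw [intCast_dvd_iff] at h ⊢
  simp only [re_mul, imI_mul, imJ_mul, imK_mul, re_intCast, imI_intCast, imJ_intCast, imK_intCast,
    zero_mul, sub_zero, add_zero] at h
  exact ⟨hpl.dvd_of_dvd_mul_left h.1, hpl.dvd_of_dvd_mul_left h.2.1,
    hpl.dvd_of_dvd_mul_left h.2.2.1, hpl.dvd_of_dvd_mul_left h.2.2.2⟩

/-- Two quaternions that annihilate the same nonzero quaternion modulo an odd prime `p`
are orthogonal modulo `p` in the strong sense `y * star x ≡ 0`. -/
lemma dvd_mul_star_of_dvd_mul {p : ℕ} (hp : p.Prime) (hp2 : p ≠ 2) {x y w : ℍ[ℤ]}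
    (hw : ¬ ((p : ℤ) : ℍ[ℤ]) ∣ w) (hx : ((p : ℤ) : ℍ[ℤ]) ∣ x * w)
    (hy : ((p : ℤ) : ℍ[ℤ]) ∣ y * w) : ((p : ℤ) : ℍ[ℤ]) ∣ y * star x := by
  have hpZ : Prime (p : ℤ) := Nat.prime_iff_prime_int.mp hp
  have hcop2 : IsCoprime (p : ℤ) 2 := by
    refine Nat.isCoprime_iff_coprime (m := p) (n := 2) |>.2 ?_
    exact (Nat.coprime_primes hp Nat.prime_two).2 hp2
  have main : ∀ z : ℍ[ℤ], ((p : ℤ) : ℍ[ℤ]) ∣ (w * z + star (w * z)) * (y * star x) := by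
    intro z
    have hc : (w * z + star (w * z)) * (y * star x) = y * (w * z + star (w * z)) * star x := by
      have : w * z + star (w * z) = ((2 * (w * z).re : ℤ) : ℍ[ℤ]) := by
        rw [Quaternion.self_add_star]; push_cast; rfl
      rw [this, ← mul_assoc, (Int.cast_commute _ y).eq]
    have e : y * (w * z + star (w * z)) * star x
        = (y * w) * (z * star x) + y * star (x * w * z) := by
      simp only [star_mul]; noncomm_ring
    rw [hc, e]
    exact dvd_add (hy.mul_right _) (intCast_dvd_mul_left (intCast_dvd_star (hx.mul_right _)) _)
  have step : ∀ z : ℍ[ℤ], ¬ (p : ℤ) ∣ (w * z).re → ((p : ℤ) : ℍ[ℤ]) ∣ y * star x := by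
    intro z hz
    have h := main z
    have : w * z + star (w * z) = ((2 * (w * z).re : ℤ) : ℍ[ℤ]) := by
      rw [Quaternion.self_add_star]; push_cast; rfl
    rw [this] at h
    refine intCast_dvd_of_dvd_intCast_mul ?_ h
    exact IsCoprime.mul_right hcop2 ((Prime.coprime_iff_not_dvd hpZ).2 hz)
  by_contra hcon
  apply hw
  rw [intCast_dvd_iff]
  refine ⟨?_, ?_, ?_, ?_⟩
  · by_contra h; exact hcon (step 1 (by simpa using h))
  · by_contra h; exact hcon (step (quat 0 1 0 0) (by simpa using h))
  · by_contra h; exact hcon (step (quat 0 0 1 0) (by simpa using h))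
  · by_contra h; exact hcon (step (quat 0 0 0 1) (by simpa using h))

/-- The reduction modulo `p` of an integral quaternion, as a `2 × 2` matrix
(a ring homomorphism when `a ^ 2 + b ^ 2 = -1`). -/
def rho {p : ℕ} (a b : ZMod p) (v : ℍ[ℤ]) : Matrix (Fin 2) (Fin 2) (ZMod p) :=
  !![v.re + a * v.imJ - b * v.imK, -v.imI + b * v.imJ + a * v.imK;
     v.imI + b * v.imJ + a * v.imK, v.re - a * v.imJ + b * v.imK]

lemma rho_mul {p : ℕ} {a b : ZMod p} (hab : a ^ 2 + b ^ 2 = -1) (v w : ℍ[ℤ]) :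
    rho a b (v * w) = rho a b v * rho a b w := by
  ext i j
  fin_cases i <;> fin_cases j <;>
    simp [rho, Matrix.mul_apply, Fin.sum_univ_two, re_mul, imI_mul, imJ_mul, imK_mul]
  · linear_combination (-(v.imJ : ZMod p) * w.imJ - v.imK * w.imK) * hab
  · linear_combination (v.imK * w.imJ - v.imJ * w.imK : ZMod p) * hab
  · linear_combination (-v.imK * w.imJ + v.imJ * w.imK : ZMod p) * hab
  · linear_combination (-(v.imJ : ZMod p) * w.imJ - v.imK * w.imK) * hab

lemma det_rho {p : ℕ} {a b : ZMod p} (hab : a ^ 2 + b ^ 2 = -1) (v : ℍ[ℤ]) :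
    (rho a b v).det = ((normSq v : ℤ) : ZMod p) := by
  rw [normSq_def', Matrix.det_fin_two]
  simp [rho]
  linear_combination (-(v.imJ : ZMod p) ^ 2 - v.imK ^ 2) * hab

lemma rho_intCast_mul {p : ℕ} (a b : ZMod p) (m : ℤ) (v : ℍ[ℤ]) :
    rho a b ((m : ℍ[ℤ]) * v) = (m : ZMod p) • rho a b v := by
  ext i j
  fin_cases i <;> fin_cases j <;>
    simp [rho, re_mul, imI_mul, imJ_mul, imK_mul] <;> ring

lemma rho_sub {p : ℕ} (a b : ZMod p) (v w : ℍ[ℤ]) :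
    rho a b (v - w) = rho a b v - rho a b w := by
  ext i j
  fin_cases i <;> fin_cases j <;> simp [rho] <;> ring

lemma dvd_of_rho_eq_zero {p : ℕ} (hp : p.Prime) (hp2 : p ≠ 2) {a b : ZMod p}
    (hab : a ^ 2 + b ^ 2 = -1) {v : ℍ[ℤ]} (h : rho a b v = 0) : ((p : ℤ) : ℍ[ℤ]) ∣ v := by
  have := Fact.mk hp
  have h2 : (2 : ZMod p) ≠ 0 := by
    intro h2
    have : ((2 : ℕ) : ZMod p) = 0 := by exact_mod_cast h2
    rw [ZMod.natCast_eq_zero_iff] at this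
    exact hp2 ((Nat.prime_dvd_prime_iff_eq hp Nat.prime_two).1 this)
  have e00 := congrFun (congrFun h 0) 0
  have e01 := congrFun (congrFun h 0) 1
  have e10 := congrFun (congrFun h 1) 0
  have e11 := congrFun (congrFun h 1) 1
  simp [rho] at e00 e01 e10 e11
  rw [intCast_dvd_iff]
  simp only [← ZMod.intCast_zmod_eq_zero_iff_dvd]
  refine ⟨?_, ?_, ?_, ?_⟩ <;> apply mul_left_cancel₀ h2 <;> rw [mul_zero]
  · linear_combination e00 + e11
  · linear_combination e10 - e01
  · linear_combination -a * (e00 - e11) - b * (e01 + e10) - 2 * v.imJ * (-hab)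
  · linear_combination b * (e00 - e11) - a * (e01 + e10) - 2 * v.imK * (-hab)

/-- Representatives of the rows of the projective line over `ZMod p`. -/
def projRow (p : ℕ) : Option (ZMod p) → Fin 2 → ZMod p
  | none => ![0, 1]
  | some s => ![1, s]

lemma projRow_ne_zero {p : ℕ} (hp : p.Prime) (I : Option (ZMod p)) : projRow p I ≠ 0 := by
  have := Fact.mk hp
  cases I with
  | none => intro h; simpa [projRow] using congrFun h 1
  | some s => intro h; simpa [projRow] using congrFun h 0

lemma eq_zero_of_projRow_vecMul {p : ℕ} (hp : p.Prime) {I I' : Option (ZMod p)} (hI : I ≠ I')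
    {A : Matrix (Fin 2) (Fin 2) (ZMod p)} (h : Matrix.vecMul (projRow p I) A = 0)
    (h' : Matrix.vecMul (projRow p I') A = 0) : A = 0 := by
  have := Fact.mk hp
  have h0 := congrFun h 0
  have h1 := congrFun h 1
  have h0' := congrFun h' 0
  have h1' := congrFun h' 1
  cases I with
  | none =>
    cases I' with
    | none => exact absurd rfl hI
    | some s =>
      simp [projRow, Matrix.vecMul, dotProduct, Fin.sum_univ_two] at h0 h1 h0' h1'
      ext i j
      fin_cases i <;> fin_cases j <;> simp_all
  | some s =>
    cases I' with
    | none =>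
      simp [projRow, Matrix.vecMul, dotProduct, Fin.sum_univ_two] at h0 h1 h0' h1'
      ext i j
      fin_cases i <;> fin_cases j <;> simp_all
    | some t =>
      have hst : s - t ≠ 0 := sub_ne_zero.2 fun e => hI (by rw [e])
      simp [projRow, Matrix.vecMul, dotProduct, Fin.sum_univ_two] at h0 h1 h0' h1'
      have a10 : A 1 0 = 0 := mul_left_cancel₀ hst (by linear_combination h0 - h0')
      have a11 : A 1 1 = 0 := mul_left_cancel₀ hst (by linear_combination h1 - h1')
      ext i j
      fin_cases i <;> fin_cases j <;> simp_all

/-- Multiplying by a suitable quaternion of norm `2` or `3` removes a factor `2` or `3` from the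
norm. -/
lemma exists_dvd_mul_of_normSq_two {m : ℤ} (hm : m % 2 = 1) {v : ℍ[ℤ]} (hv : normSq v = 2 * m) :
    ∃ u : ℍ[ℤ], normSq u = 2 ∧ ((2 : ℤ) : ℍ[ℤ]) ∣ v * u := by
  rw [normSq_def'] at hv
  have key : ∀ x : ℤ, (x % 2 = 0 ∧ x ^ 2 % 4 = 0) ∨ (x % 2 = 1 ∧ x ^ 2 % 4 = 1) := fun x => by
    obtain ⟨k, rfl | rfl⟩ := Int.even_or_odd' x
    · left; constructor
      · omega
      · ring_nf; omega
    · right; constructor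
      · omega
      · ring_nf; omega
  refine ⟨quat (v.re % 2) (v.imI % 2) (v.imJ % 2) (v.imK % 2), ?_, ?_⟩
  · rw [normSq_def']
    simp only [quat_re, quat_imI, quat_imJ, quat_imK]
    rcases key v.re with ⟨a, a'⟩ | ⟨a, a'⟩ <;> rcases key v.imI with ⟨b, b'⟩ | ⟨b, b'⟩ <;>
      rcases key v.imJ with ⟨c, c'⟩ | ⟨c, c'⟩ <;> rcases key v.imK with ⟨e, e'⟩ | ⟨e, e'⟩ <;>
      rw [a, b, c, e] <;> omega
  · obtain ⟨A, hA⟩ : ∃ A, v.re % 2 = v.re - 2 * A := ⟨v.re / 2, by omega⟩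
    obtain ⟨B, hB⟩ : ∃ A, v.imI % 2 = v.imI - 2 * A := ⟨v.imI / 2, by omega⟩
    obtain ⟨C, hC⟩ : ∃ A, v.imJ % 2 = v.imJ - 2 * A := ⟨v.imJ / 2, by omega⟩
    obtain ⟨E, hE⟩ : ∃ A, v.imK % 2 = v.imK - 2 * A := ⟨v.imK / 2, by omega⟩
    rw [hA, hB, hC, hE, intCast_dvd_iff]
    simp only [re_mul, imI_mul, imJ_mul, imK_mul, quat_re, quat_imI, quat_imJ, quat_imK]
    refine ⟨⟨v.re ^ 2 - m - v.re * A + v.imI * B + v.imJ * C + v.imK * E, ?_⟩,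
      ⟨v.re * v.imI - v.re * B - v.imI * A - v.imJ * E + v.imK * C, ?_⟩,
      ⟨v.re * v.imJ - v.re * C - v.imJ * A - v.imK * B + v.imI * E, ?_⟩,
      ⟨v.re * v.imK - v.re * E - v.imK * A - v.imI * C + v.imJ * B, ?_⟩⟩
    · linear_combination -hv
    all_goals ring

lemma exists_dvd_mul_of_normSq_three {m : ℤ} (hm : m % 3 ≠ 0) {v : ℍ[ℤ]}
    (hv : normSq v = 3 * m) :
    ∃ u : ℍ[ℤ], normSq u = 3 ∧ ((3 : ℤ) : ℍ[ℤ]) ∣ v * u := by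
  rw [normSq_def'] at hv
  have key : ∀ x : ℤ, ∃ y k : ℤ, x = y + 3 * k ∧ ((y = 0 ∧ x ^ 2 % 9 = 0) ∨
      (y ^ 2 = 1 ∧ x ^ 2 % 3 = 1)) := fun x => by
    obtain ⟨k, hk⟩ : ∃ k, x = 3 * k ∨ x = 1 + 3 * k ∨ x = -1 + 3 * k :=
      ⟨(x + 1) / 3, by omega⟩
    rcases hk with h | h | h
    · exact ⟨0, k, by omega, Or.inl ⟨rfl, by rw [h]; ring_nf; omega⟩⟩
    · exact ⟨1, k, by omega, Or.inr ⟨by norm_num, by rw [h]; ring_nf; omega⟩⟩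
    · exact ⟨-1, k, by omega, Or.inr ⟨by norm_num, by rw [h]; ring_nf; omega⟩⟩
  obtain ⟨a, A, hA, ha⟩ := key v.re
  obtain ⟨b, B, hB, hb⟩ := key v.imI
  obtain ⟨c, C, hC, hc⟩ := key v.imJ
  obtain ⟨e, E, hE, he⟩ := key v.imK
  refine ⟨quat a (-b) (-c) (-e), ?_, ?_⟩
  · rw [normSq_def']
    simp only [quat_re, quat_imI, quat_imJ, quat_imK, neg_sq]
    rcases ha with ⟨a1, a'⟩ | ⟨a1, a'⟩ <;> rcases hb with ⟨b1, b'⟩ | ⟨b1, b'⟩ <;>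
      rcases hc with ⟨c1, c'⟩ | ⟨c1, c'⟩ <;> rcases he with ⟨e1, e'⟩ | ⟨e1, e'⟩ <;>
      simp only [a1, b1, c1, e1] <;> omega
  · rw [intCast_dvd_iff]
    have a1 : a = v.re - 3 * A := by omega
    have b1 : b = v.imI - 3 * B := by omega
    have c1 : c = v.imJ - 3 * C := by omega
    have e1 : e = v.imK - 3 * E := by omega
    rw [a1, b1, c1, e1]
    simp only [re_mul, imI_mul, imJ_mul, imK_mul, quat_re, quat_imI, quat_imJ, quat_imK]
    refine ⟨⟨m - v.re * A - v.imI * B - v.imJ * C - v.imK * E, ?_⟩,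
      ⟨v.re * B - v.imI * A + v.imJ * E - v.imK * C, ?_⟩,
      ⟨v.re * C - v.imJ * A + v.imK * B - v.imI * E, ?_⟩,
      ⟨v.re * E - v.imK * A + v.imI * C - v.imJ * B, ?_⟩⟩
    · linear_combination hv
    all_goals ring

lemma exists_small_mem_class {p : ℕ} (hp : p.Prime) {a b : ZMod p}
    (I : Option (ZMod p)) :
    ∃ v : ℍ[ℤ], v ≠ 0 ∧ normSq v ≤ 4 * (Nat.sqrt p * Nat.sqrt p : ℕ) ∧ Nat.sqrt p * Nat.sqrt p < p ∧
      Matrix.vecMul (projRow p I) (rho a b v) = 0 := by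
  have := Fact.mk hp
  set k := Nat.sqrt p with hk
  have hk1 : k * k < p := by
    refine lt_of_le_of_ne (Nat.sqrt_le p) fun h => ?_
    rw [← h, Nat.prime_mul_iff] at hp
    rcases hp with ⟨hp, h1⟩ | ⟨hp, h1⟩ <;> exact Nat.not_prime_one (h1 ▸ hp)
  have hk2 : p < (k + 1) * (k + 1) := Nat.lt_succ_sqrt p
  let Q : (Fin 4 → Fin (k + 1)) → ℍ[ℤ] := fun x =>
    quat ((x 0 : ℕ) : ℤ) ((x 1 : ℕ) : ℤ) ((x 2 : ℕ) : ℤ) ((x 3 : ℕ) : ℤ)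
  have hcard : Fintype.card (Fin 2 → ZMod p) < Fintype.card (Fin 4 → Fin (k + 1)) := by
    simp only [Fintype.card_fun, ZMod.card, Fintype.card_fin]
    calc p ^ 2 < ((k + 1) * (k + 1)) ^ 2 := Nat.pow_lt_pow_left hk2 (by norm_num)
      _ = (k + 1) ^ 4 := by ring
  obtain ⟨x, y, hxy, he⟩ := Fintype.exists_ne_map_eq_of_card_lt
    (fun x => Matrix.vecMul (projRow p I) (rho a b (Q x))) hcard
  have hb : ∀ i, ((x i : ℕ) : ℤ) - ((y i : ℕ) : ℤ) ≤ k ∧ -(k : ℤ) ≤ (x i : ℕ) - ((y i : ℕ) : ℤ) := by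
    intro i
    have := (x i).2
    have := (y i).2
    omega
  have hsq : ∀ i, (((x i : ℕ) : ℤ) - ((y i : ℕ) : ℤ)) ^ 2 ≤ k * k := fun i => by
    nlinarith [(hb i).1, (hb i).2]
  refine ⟨Q x - Q y, ?_, ?_, hk1, ?_⟩
  · intro h
    apply hxy
    have h0 := congrArg QuaternionAlgebra.re h
    have h1 := congrArg QuaternionAlgebra.imI h
    have h2 := congrArg QuaternionAlgebra.imJ h
    have h3 := congrArg QuaternionAlgebra.imK h
    simp only [Q, re_sub, imI_sub, imJ_sub, imK_sub, quat_re, quat_imI, quat_imJ, quat_imK,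
      re_zero, imI_zero, imJ_zero, imK_zero] at h0 h1 h2 h3
    funext i
    apply Fin.ext
    fin_cases i <;> simp only [Fin.zero_eta, Fin.mk_one, Fin.reduceFinMk] <;> omega
  · rw [normSq_def']
    simp only [Q, re_sub, imI_sub, imJ_sub, imK_sub, quat_re, quat_imI, quat_imJ, quat_imK]
    push_cast
    linarith [hsq 0, hsq 1, hsq 2, hsq 3]
  · rw [rho_sub, Matrix.vecMul_sub, sub_eq_zero]
    exact he

lemma exists_mem_class_of_mul {p : ℕ} (hp : p.Prime) {a b : ZMod p}
    (hab : a ^ 2 + b ^ 2 = -1) {r : Fin 2 → ZMod p} {j : ℤ} (hj : (j : ZMod p) ≠ 0) (hj0 : j ≠ 0)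
    {v u : ℍ[ℤ]} (hv : normSq v = p * j) (hr : Matrix.vecMul r (rho a b v) = 0)
    (hu : normSq u = j) (hd : (j : ℍ[ℤ]) ∣ v * u) :
    ∃ q : ℍ[ℤ], normSq q = p ∧ Matrix.vecMul r (rho a b q) = 0 := by
  have := Fact.mk hp
  obtain ⟨q, hq⟩ := hd
  refine ⟨q, ?_, ?_⟩
  · have h := congrArg normSq hq
    rw [map_mul, map_mul, hv, hu, normSq_intCast] at h
    have : j ^ 2 * normSq q = j ^ 2 * p := by
      simp only [Int.cast_id] at h
      linarith
    exact mul_left_cancel₀ (pow_ne_zero 2 hj0) this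
  · have h : Matrix.vecMul r (rho a b (v * u)) = 0 := by
      rw [rho_mul hab, ← Matrix.vecMul_vecMul, hr, Matrix.zero_vecMul]
    rw [hq, rho_intCast_mul, Matrix.vecMul_smul] at h
    exact (smul_eq_zero.1 h).resolve_left hj

lemma exists_mem_class {p : ℕ} (hp : p.Prime) (hp2 : p ≠ 2) {a b : ZMod p}
    (hab : a ^ 2 + b ^ 2 = -1) (I : Option (ZMod p)) :
    ∃ q : ℍ[ℤ], normSq q = p ∧ Matrix.vecMul (projRow p I) (rho a b q) = 0 := by
  have := Fact.mk hp
  obtain ⟨v, hv0, hvle, hsq, hv⟩ := exists_small_mem_class hp (a := a) (b := b) I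
  have hdet : (rho a b v).det = 0 :=
    Matrix.exists_vecMul_eq_zero_iff.1 ⟨_, projRow_ne_zero hp I, hv⟩
  rw [det_rho hab, ZMod.intCast_zmod_eq_zero_iff_dvd] at hdet
  obtain ⟨j, hj⟩ := hdet
  have hpos : 0 < normSq v := lt_of_le_of_ne normSq_nonneg (Ne.symm (normSq_ne_zero.2 hv0))
  have hp0 : (0 : ℤ) < p := by exact_mod_cast hp.pos
  have hj1 : 0 < j := by rw [hj] at hpos; exact (mul_pos_iff_of_pos_left hp0).1 hpos
  have hvlt : normSq v < 4 * p := hvle.trans_lt (by exact_mod_cast (by omega))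
  have hj4 : j < 4 := by rw [hj] at hvlt; nlinarith
  have hodd : p % 2 = 1 := hp.eq_two_or_odd.resolve_left hp2
  obtain rfl | rfl | rfl : j = 1 ∨ j = 2 ∨ j = 3 := by omega
  · exact ⟨v, by rw [hj, mul_one], hv⟩
  · obtain ⟨u, hu, hd⟩ := exists_dvd_mul_of_normSq_two (m := p) (by omega)
      (v := v) (by rw [hj]; ring)
    refine exists_mem_class_of_mul hp hab ?_ (by norm_num) hj hv hu hd
    rw [Ne, ZMod.intCast_zmod_eq_zero_iff_dvd]
    intro h
    exact hp2 ((Nat.prime_dvd_prime_iff_eq hp Nat.prime_two).1 (by exact_mod_cast h))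
  · have hp3 : p ≠ 3 := by
      rintro rfl
      have h9 : normSq v = 9 := by rw [hj]; norm_num
      have h1 : Nat.sqrt 3 < 2 := Nat.sqrt_lt.2 (by norm_num)
      have : Nat.sqrt 3 * Nat.sqrt 3 ≤ 1 := by nlinarith
      omega
    have hp3' : ¬ 3 ∣ p := fun h => hp3 ((Nat.prime_dvd_prime_iff_eq Nat.prime_three hp).1 h).symm
    obtain ⟨u, hu, hd⟩ := exists_dvd_mul_of_normSq_three (m := p) (by omega)
      (v := v) (by rw [hj]; ring)
    refine exists_mem_class_of_mul hp hab ?_ (by norm_num) hj hv hu hd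
    rw [Ne, ZMod.intCast_zmod_eq_zero_iff_dvd]
    intro h
    exact hp3 ((Nat.prime_dvd_prime_iff_eq hp Nat.prime_three).1 (by exact_mod_cast h))

/-- The integral quaternions of norm `n`. -/
def normFin (n : ℤ) : Finset ℍ[ℤ] := (finite_normSq n).toFinset

open scoped Classical in
/-- The integral quaternions of norm `n` that are not divisible by any prime number. -/
def primFin (n : ℤ) : Finset ℍ[ℤ] :=
  (normFin n).filter fun v => ∀ l : ℕ, l.Prime → ¬ ((l : ℤ) : ℍ[ℤ]) ∣ v

lemma mem_normFin {n : ℤ} {v : ℍ[ℤ]} : v ∈ normFin n ↔ normSq v = n := by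
  simp [normFin]

lemma mem_primFin {n : ℤ} {v : ℍ[ℤ]} :
    v ∈ primFin n ↔ normSq v = n ∧ ∀ l : ℕ, l.Prime → ¬ ((l : ℤ) : ℍ[ℤ]) ∣ v := by
  simp [primFin, mem_normFin]

lemma coe_eq_intCast (z : ℤ) : Quaternion.coe z = ((z : ℤ) : ℍ[ℤ]) := by
  have h := Quaternion.coe_intCast (R := ℤ) z
  rwa [Int.cast_id] at h

lemma intCast_prime_ne_zero {p : ℕ} (hp : p.Prime) : ((p : ℤ) : ℍ[ℤ]) ≠ 0 := by
  rw [← normSq_ne_zero, normSq_intCast]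
  exact pow_ne_zero 2 (Int.natCast_ne_zero.2 hp.ne_zero)

lemma not_dvd_of_normSq_prime {p : ℕ} (hp : p.Prime) {q : ℍ[ℤ]} (hq : normSq q = p) :
    ¬ ((p : ℤ) : ℍ[ℤ]) ∣ q := by
  rintro ⟨w, rfl⟩
  rw [map_mul, normSq_intCast] at hq
  have hp0 : (p : ℤ) ≠ 0 := by exact_mod_cast hp.ne_zero
  have h1 : (p : ℤ) * normSq w = 1 := by
    apply mul_left_cancel₀ hp0
    simp only [Int.cast_id] at hq
    linarith
  have := Int.eq_one_or_neg_one_of_mul_eq_one h1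
  have := hp.two_le
  omega

lemma exists_unit_mul_of_dvd {p : ℕ} (hp : p.Prime) {x y : ℍ[ℤ]} (hx : normSq x = p)
    (hy : normSq y = p) (h : ((p : ℤ) : ℍ[ℤ]) ∣ y * star x) :
    ∃ e ∈ normFin 1, y = e * x := by
  obtain ⟨e, he⟩ := h
  have hp0 : (p : ℤ) ≠ 0 := by exact_mod_cast hp.ne_zero
  refine ⟨e, mem_normFin.2 ?_, ?_⟩
  · have h := congrArg normSq he
    rw [map_mul, map_mul, normSq_star, hx, hy, normSq_intCast] at h
    simp only [Int.cast_id] at h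
    exact mul_left_cancel₀ (pow_ne_zero 2 hp0) (by linarith)
  · apply mul_left_cancel₀ (intCast_prime_ne_zero hp)
    rw [← mul_assoc, ← he, mul_assoc, star_mul_self, hx, coe_eq_intCast, (Int.cast_commute _ y).eq]

lemma card_normFin_prime_ge {p : ℕ} (hp : p.Prime) (hp2 : p ≠ 2) :
    (p + 1) * (normFin 1).card ≤ (normFin p).card := by
  have := Fact.mk hp
  obtain ⟨a, b, hab⟩ := ZMod.sq_add_sq p (-1)
  choose q hq hqI using exists_mem_class hp hp2 hab
  have hcard : (p + 1) * (normFin 1).card =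
      ((Finset.univ : Finset (Option (ZMod p))) ×ˢ normFin 1).card := by
    rw [Finset.card_product, Finset.card_univ, Fintype.card_option, ZMod.card]
  rw [hcard]
  refine Finset.card_le_card_of_injOn (fun x => q x.1 * x.2) ?_ ?_
  · rintro ⟨I, e⟩ h
    simp only [Finset.coe_product, Finset.coe_univ, Set.mem_prod, Set.mem_univ, true_and,
      Finset.mem_coe, mem_normFin] at h ⊢
    rw [map_mul, hq, h, mul_one]
  · rintro ⟨I, e⟩ h ⟨I', e'⟩ h' heq
    simp only [Finset.coe_product, Finset.coe_univ, Set.mem_prod, Set.mem_univ, true_and,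
      Finset.mem_coe, mem_normFin] at h h' heq
    have hker : ∀ J e, Matrix.vecMul (projRow p J) (rho a b (q J * e)) = 0 := fun J e => by
      rw [rho_mul hab, ← Matrix.vecMul_vecMul, hqI, Matrix.zero_vecMul]
    have hII : I = I' := by
      by_contra hne
      have h0 := eq_zero_of_projRow_vecMul hp hne (hker I e) (heq ▸ hker I' e')
      refine not_dvd_of_normSq_prime hp (q := q I * e) ?_ (dvd_of_rho_eq_zero hp hp2 hab h0)
      rw [map_mul, hq, h, mul_one]
    subst hII
    have hq0 : q I ≠ 0 := by
      rw [← normSq_ne_zero, hq]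
      exact_mod_cast hp.ne_zero
    rw [mul_left_cancel₀ hq0 heq]

lemma card_annihilator_le {p : ℕ} (hp : p.Prime) (hp2 : p ≠ 2) {w : ℍ[ℤ]}
    (hw : ¬ ((p : ℤ) : ℍ[ℤ]) ∣ w) (s : Finset ℍ[ℤ])
    (hs : ∀ q ∈ s, normSq q = p ∧ ((p : ℤ) : ℍ[ℤ]) ∣ q * w) : s.card ≤ (normFin 1).card := by
  classical
  rcases s.eq_empty_or_nonempty with rfl | ⟨x, hx⟩
  · simp
  refine (Finset.card_le_card (t := (normFin 1).image fun e => e * x) ?_).trans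
    Finset.card_image_le
  intro y hy
  obtain ⟨e, he, rfl⟩ := exists_unit_mul_of_dvd hp (hs x hx).1 (hs y hy).1
    (dvd_mul_star_of_dvd_mul hp hp2 hw (hs x hx).2 (hs y hy).2)
  exact Finset.mem_image.2 ⟨e, he, rfl⟩

lemma card_fiber_le {p : ℕ} (hp : p.Prime) (hp2 : p ≠ 2) {v : ℍ[ℤ]}
    (hv : ¬ ((p : ℤ) : ℍ[ℤ]) ∣ v) (s : Finset (ℍ[ℤ] × ℍ[ℤ]))
    (hs : ∀ x ∈ s, normSq x.1 = p ∧ x.1 * x.2 = v) : s.card ≤ (normFin 1).card := by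
  classical
  rcases s.eq_empty_or_nonempty with rfl | ⟨x, hx⟩
  · simp
  refine (Finset.card_le_card (t := (normFin 1).image fun e => (x.1 * e, star e * x.2)) ?_).trans
    Finset.card_image_le
  intro y hy
  have hdvd : ∀ z ∈ s, ((p : ℤ) : ℍ[ℤ]) ∣ star z.1 * v := fun z hz => by
    rw [← (hs z hz).2, ← mul_assoc, star_mul_self, (hs z hz).1, coe_eq_intCast]
    exact ⟨z.2, rfl⟩
  obtain ⟨e, he, hye⟩ := exists_unit_mul_of_dvd hp (x := star x.1) (y := star y.1)
    (by rw [normSq_star, (hs x hx).1]) (by rw [normSq_star, (hs y hy).1])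
    (dvd_mul_star_of_dvd_mul hp hp2 hv (hdvd x hx) (hdvd y hy))
  have hye' : y.1 = x.1 * star e := by
    have := congrArg star hye
    simpa using this
  have hx0 : x.1 ≠ 0 := by
    rw [← normSq_ne_zero, (hs x hx).1]
    exact_mod_cast hp.ne_zero
  have h2 : star e * y.2 = x.2 := by
    apply mul_left_cancel₀ hx0
    rw [← mul_assoc, ← hye', (hs y hy).2, (hs x hx).2]
  rw [mem_normFin] at he
  have hee : e * star e = 1 := by rw [self_mul_star, he]; simp
  refine Finset.mem_image.2 ⟨star e, mem_normFin.2 (by rw [normSq_star, he]), ?_⟩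
  apply Prod.ext
  · exact hye'.symm
  · simp only [star_star]
    rw [← h2, ← mul_assoc, hee, one_mul]

lemma mul_card_primFin_le {p : ℕ} (hp : p.Prime) (hp2 : p ≠ 2) (m : ℤ) :
    p * (primFin m).card ≤ (primFin (p * m)).card := by
  classical
  set u := (normFin 1).card with hu
  have hu0 : 0 < u := Finset.card_pos.2 ⟨1, mem_normFin.2 (by simp)⟩
  set P := normFin p ×ˢ primFin m with hP
  have hgood : (P.filter fun x => ¬ ((p : ℤ) : ℍ[ℤ]) ∣ x.1 * x.2).card ≤
      u * (primFin (p * m)).card := by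
    refine Finset.card_le_mul_card_image_of_maps_to (f := fun x => x.1 * x.2) ?_ u ?_
    · rintro ⟨q, w⟩ h
      simp only [hP, Finset.mem_filter, Finset.mem_product, mem_normFin, mem_primFin] at h ⊢
      refine ⟨by rw [map_mul, h.1.1, h.1.2.1], fun l hl hd => ?_⟩
      by_cases hlp : l = p
      · exact h.2 (hlp ▸ hd)
      · have := intCast_dvd_mul_left hd (star q)
        rw [← mul_assoc, star_mul_self, h.1.1, coe_eq_intCast] at this
        refine h.1.2.2 l hl (intCast_dvd_of_dvd_intCast_mul (p := p) ?_ this)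
        rw [Nat.isCoprime_iff_coprime]
        exact (Nat.coprime_primes hl hp).2 hlp
    · intro v hv
      refine card_fiber_le hp hp2 ((mem_primFin.1 hv).2 p hp) _ ?_
      rintro ⟨q, w⟩ h
      simp only [hP, Finset.mem_filter, Finset.mem_product, mem_normFin] at h
      exact ⟨h.1.1.1, h.2⟩
  have hbad : (P.filter fun x => ((p : ℤ) : ℍ[ℤ]) ∣ x.1 * x.2).card ≤
      u * (primFin m).card := by
    refine Finset.card_le_mul_card_image_of_maps_to (f := fun x => x.2) ?_ u ?_
    · rintro ⟨q, w⟩ h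
      simp only [hP, Finset.mem_filter, Finset.mem_product] at h
      exact h.1.2
    · intro w hw
      refine le_trans (le_of_eq ?_) (card_annihilator_le hp hp2 ((mem_primFin.1 hw).2 p hp)
        ((normFin p).filter fun q => ((p : ℤ) : ℍ[ℤ]) ∣ q * w) ?_)
      · refine Finset.card_bij (fun x _ => x.1) ?_ ?_ ?_
        · rintro ⟨q, w'⟩ h
          simp only [hP, Finset.mem_filter, Finset.mem_product] at h ⊢
          obtain ⟨⟨⟨h1, h2⟩, h3⟩, rfl⟩ := h
          exact ⟨h1, h3⟩
        · rintro ⟨q, w1⟩ h1 ⟨q', w2⟩ h2 heq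
          simp only [Finset.mem_filter] at h1 h2
          exact Prod.ext heq (h1.2.trans h2.2.symm)
        · intro q hq
          simp only [Finset.mem_filter] at hq
          exact ⟨(q, w), Finset.mem_filter.2 ⟨Finset.mem_filter.2
            ⟨Finset.mem_product.2 ⟨hq.1, hw⟩, hq.2⟩, rfl⟩, rfl⟩
      · intro q hq
        simp only [Finset.mem_filter, mem_normFin] at hq
        exact hq
  have htot := Finset.card_filter_add_card_filter_not (s := P)
    (fun x => ((p : ℤ) : ℍ[ℤ]) ∣ x.1 * x.2)
  rw [hP, Finset.card_product, ← hP] at htot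
  have hS := Nat.mul_le_mul_right (primFin m).card (card_normFin_prime_ge hp hp2)
  rw [← hu] at hS
  refine Nat.le_of_mul_le_mul_left (c := u) ?_ hu0
  nlinarith

lemma card_primFin_ge {n : ℕ} (hn : Odd n) : n ≤ (primFin n).card := by
  induction n using induction_on_primes with
  | zero => simp
  | one =>
    refine Finset.card_pos.2 ⟨1, mem_primFin.2 ⟨by simp, fun l hl h => ?_⟩⟩
    rw [intCast_dvd_iff] at h
    have := Int.eq_one_of_dvd_one (by positivity) h.1
    exact hl.one_lt.ne' (by exact_mod_cast this)
  | prime_mul p a hp ih =>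
    rw [Nat.odd_mul] at hn
    have h := mul_card_primFin_le hp (by rintro rfl; exact absurd hn.1 (by decide)) a
    push_cast
    exact (Nat.mul_le_mul_left p (ih hn.2)).trans h

/-- An odd number `n` has at least `n` representations as a sum of four squares. -/
lemma card_normFin_ge {n : ℕ} (hn : Odd n) : n ≤ (normFin n).card := by
  classical
  exact (card_primFin_ge hn).trans (Finset.card_filter_le _ _)

lemma abs_le_of_sum_sq_le {d : ℕ} {u : V d} {n : ℕ} (h : ∑ i, u i ^ 2 ≤ (n : ℤ)) (i : Fin d) :
    |u i| ≤ n := by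
  have h1 : u i ^ 2 ≤ n :=
    (Finset.single_le_sum (fun j _ => sq_nonneg (u j)) (Finset.mem_univ i)).trans h
  have h2 : |u i| ≤ u i ^ 2 := by
    rw [← sq_abs]
    rcases (abs_nonneg (u i)).eq_or_lt with h0 | h0
    · simp [← h0]
    · nlinarith
  exact h2.trans h1

lemma finite_sph (d lam : ℕ) : (sph d lam).Finite := by
  have hf : (Set.Icc (fun _ => -lam : V d) (fun _ => lam)).Finite := Set.finite_Icc _ _
  refine (hf.prod hf).subset ?_
  rintro ⟨u, v⟩ h
  have h : (∑ i, u i ^ 2) + (∑ i, v i ^ 2) = (lam : ℤ) := h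
  have hu : 0 ≤ ∑ i, u i ^ 2 := Finset.sum_nonneg fun i _ => sq_nonneg _
  have hv : 0 ≤ ∑ i, v i ^ 2 := Finset.sum_nonneg fun i _ => sq_nonneg _
  have hu' := abs_le_of_sum_sq_le (u := u) (n := lam) (by linarith)
  have hv' := abs_le_of_sum_sq_le (u := v) (n := lam) (by linarith)
  exact ⟨⟨fun i => (abs_le.1 (hu' i)).1, fun i => (abs_le.1 (hu' i)).2⟩,
    ⟨fun i => (abs_le.1 (hv' i)).1, fun i => (abs_le.1 (hv' i)).2⟩⟩

lemma Ncount_eq (d lam : ℕ) : Ncount d lam = (finite_sph d lam).toFinset.card := by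
  rw [Ncount, Nat.card_coe_set_eq, Set.ncard_eq_toFinset_card _ (finite_sph d lam)]

lemma Ncount_pos {d : ℕ} (hd : 2 ≤ d) (lam : ℕ) : 0 < Ncount d lam := by
  rw [Ncount_eq, Finset.card_pos]
  obtain ⟨e, rfl⟩ := Nat.exists_eq_add_of_le' hd
  obtain ⟨a, b, c, x, h⟩ := Nat.sum_four_squares lam
  refine ⟨(Matrix.vecCons (a : ℤ) (Matrix.vecCons (b : ℤ) 0),
    Matrix.vecCons (c : ℤ) (Matrix.vecCons (x : ℤ) 0)), ?_⟩
  rw [Set.Finite.mem_toFinset]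
  change _ + _ = (lam : ℤ)
  simp only [Fin.sum_univ_succ, Matrix.cons_val_zero, Matrix.cons_val_succ, Pi.zero_apply]
  rw [← h]
  push_cast
  simp
  ring

/-- The value of `|u'|² + |v'|²` for `u' = 2 s + (r, 0, …, 0)` and `v' = 2 t`. -/
def evenNorm {k : ℕ} (r : ℕ) (x : (Fin (k + 1) → ℕ) × (Fin (k + 1) → ℕ)) : ℕ :=
  ((2 * x.1 0 + r) ^ 2 + ∑ i : Fin k, (2 * x.1 i.succ) ^ 2) + ∑ i, (2 * x.2 i) ^ 2

lemma evenNorm_mod_two {k : ℕ} (r : ℕ) (x : (Fin (k + 1) → ℕ) × (Fin (k + 1) → ℕ)) :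
    (evenNorm r x : ZMod 2) = r := by
  have h2 : (2 : ZMod 2) = 0 := rfl
  have h : ∀ a : ZMod 2, a ^ 2 = a := by decide
  simp [evenNorm, h2, h]

lemma evenNorm_le {k r X : ℕ} (hr : r ≤ 1) {x : (Fin (k + 1) → ℕ) × (Fin (k + 1) → ℕ)}
    (h1 : ∀ i, x.1 i < X) (h2 : ∀ i, x.2 i < X) :
    evenNorm r x ≤ 2 * (k + 1) * (2 * X) ^ 2 := by
  have e1 : (2 * x.1 0 + r) ^ 2 ≤ (2 * X) ^ 2 := Nat.pow_le_pow_left (by have := h1 0; omega) 2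
  have e2 : ∑ i : Fin k, (2 * x.1 i.succ) ^ 2 ≤ k * (2 * X) ^ 2 := by
    refine (Finset.sum_le_card_nsmul _ _ ((2 * X) ^ 2) fun i _ => ?_).trans (by simp)
    exact Nat.pow_le_pow_left (by have := h1 i.succ; omega) 2
  have e3 : ∑ i, (2 * x.2 i) ^ 2 ≤ (k + 1) * (2 * X) ^ 2 := by
    refine (Finset.sum_le_card_nsmul _ _ ((2 * X) ^ 2) fun i _ => ?_).trans (by simp)
    exact Nat.pow_le_pow_left (by have := h2 i; omega) 2
  unfold evenNorm
  nlinarith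

/-- The lattice point built from `u' = 2 s + (r, 0, …, 0)`, `v' = 2 t` and a quaternion. -/
def sphPoint {k : ℕ} (r : ℕ) (x : (Fin (k + 1) → ℕ) × (Fin (k + 1) → ℕ)) (q : ℍ[ℤ]) :
    V (k + 3) × V (k + 3) :=
  (Matrix.vecCons q.re (Matrix.vecCons q.imI
      (Matrix.vecCons (2 * x.1 0 + r : ℤ) fun i => 2 * x.1 i.succ)),
    Matrix.vecCons q.imJ (Matrix.vecCons q.imK fun i => 2 * x.2 i))

lemma sphPoint_mem {k r lam : ℕ} {x : (Fin (k + 1) → ℕ) × (Fin (k + 1) → ℕ)} {q : ℍ[ℤ]}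
    (h : evenNorm r x + normSq q = lam) : sphPoint r x q ∈ sph (k + 3) lam := by
  change _ + _ = (lam : ℤ)
  rw [← h, normSq_def', evenNorm]
  simp only [sphPoint, Fin.sum_univ_succ, Matrix.cons_val_zero, Matrix.cons_val_succ]
  push_cast
  ring

lemma sphPoint_injective {k r : ℕ} {x y : (Fin (k + 1) → ℕ) × (Fin (k + 1) → ℕ)} {q w : ℍ[ℤ]}
    (h : sphPoint r x q = sphPoint r y w) : x = y ∧ q = w := by
  obtain ⟨h1, h2⟩ := Prod.ext_iff.1 h
  simp only [sphPoint, Matrix.vecCons_inj] at h1 h2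
  obtain ⟨a1, a2, a3, a4⟩ := h1
  obtain ⟨b1, b2, b3⟩ := h2
  refine ⟨Prod.ext (funext fun i => ?_) (funext fun i => ?_), QuaternionAlgebra.ext a1 a2 b1 b2⟩
  · refine Fin.cases ?_ (fun i => ?_) i
    · omega
    · have := congrFun a4 i
      omega
  · have := congrFun b3 i
    omega

lemma Ncount_ge_of_sq_le {k X lam : ℕ} (hX : 16 * (k + 1) * X ^ 2 ≤ lam) :
    X ^ (2 * (k + 1)) * lam ≤ 2 * Ncount (k + 3) lam := by
  classical
  obtain ⟨r, hr1, hr⟩ : ∃ r : ℕ, r ≤ 1 ∧ ((r : ZMod 2) = lam + 1) := by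
    rcases Nat.even_or_odd lam with h | h
    · exact ⟨1, le_rfl, by rw [(ZMod.natCast_eq_zero_iff_even).2 h]; simp⟩
    · exact ⟨0, zero_le_one, by rw [(ZMod.natCast_eq_one_iff_odd).2 h]; rfl⟩
  set S : Finset ((Fin (k + 1) → ℕ) × (Fin (k + 1) → ℕ)) :=
    Fintype.piFinset (fun _ => Finset.range X) ×ˢ Fintype.piFinset (fun _ => Finset.range X)
    with hS
  have hb : ∀ x ∈ S, evenNorm r x ≤ 8 * (k + 1) * X ^ 2 := fun x hx => by
    simp only [hS, Finset.mem_product, Fintype.mem_piFinset, Finset.mem_range] at hx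
    refine (evenNorm_le hr1 hx.1 hx.2).trans (le_of_eq ?_)
    ring
  have hcard : S.card = X ^ (2 * (k + 1)) := by
    simp only [hS, Finset.card_product, Fintype.card_piFinset_const, Finset.card_range]
    simp [two_mul, pow_add]
  have hinj : (S.sigma fun x => normFin ((lam - evenNorm r x : ℕ) : ℤ)).card ≤
      (finite_sph (k + 3) lam).toFinset.card := by
    refine Finset.card_le_card_of_injOn (fun z => sphPoint r z.1 z.2) ?_ ?_
    · rintro ⟨x, q⟩ h
      simp only [Finset.coe_sigma, Set.mem_sigma_iff, Finset.mem_coe, mem_normFin] at h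
      simp only [Set.Finite.coe_toFinset]
      refine sphPoint_mem ?_
      have := hb x h.1
      rw [h.2]
      have : evenNorm r x ≤ lam := by linarith
      push_cast [this]
      ring
    · rintro ⟨x, q⟩ _ ⟨y, w⟩ _ h
      obtain ⟨rfl, rfl⟩ := sphPoint_injective h
      rfl
  rw [← Ncount_eq, Finset.card_sigma] at hinj
  have hlow : ∀ x ∈ S, lam ≤ 2 * (normFin ((lam - evenNorm r x : ℕ) : ℤ)).card := fun x hx => by
    have h1 := hb x hx
    have h2 : Odd (lam - evenNorm r x) := by
      rw [← ZMod.natCast_eq_one_iff_odd, Nat.cast_sub (by linarith), evenNorm_mod_two, hr]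
      have : ∀ a : ZMod 2, a - (a + 1) = 1 := by decide
      exact this _
    have h3 := card_normFin_ge h2
    have h4 : 2 * evenNorm r x ≤ lam := by linarith
    omega
  calc X ^ (2 * (k + 1)) * lam = ∑ x ∈ S, lam := by simp [hcard]
    _ ≤ ∑ x ∈ S, 2 * (normFin ((lam - evenNorm r x : ℕ) : ℤ)).card := Finset.sum_le_sum hlow
    _ ≤ _ := by rw [← Finset.mul_sum]; exact Nat.mul_le_mul_left 2 hinj

/-- The sharp lower bound for the number of lattice points on the sphere. -/
lemma exists_Ncount_ge {d : ℕ} (hd : 3 ≤ d) :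
    ∃ c : ℝ, 0 < c ∧ ∀ lam : ℕ, c * (lam : ℝ) ^ (d - 1) ≤ Ncount d lam := by
  obtain ⟨k, rfl⟩ := Nat.exists_eq_add_of_le' hd
  refine ⟨1 / 2 * (1 / (64 * (k + 1))) ^ (k + 2), by positivity, fun lam => ?_⟩
  have hk : (0 : ℝ) < 64 * (k + 1) := by positivity
  have e : (1 / 2 * (1 / (64 * ((k : ℝ) + 1))) ^ (k + 2)) * (lam : ℝ) ^ (k + 3 - 1) =
      1 / 2 * (lam / (64 * (k + 1))) ^ (k + 2) := by
    rw [show k + 3 - 1 = k + 2 from rfl, mul_assoc, ← mul_pow]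
    congr 2
    ring
  rw [e]
  by_cases hl : lam < 16 * (k + 1)
  · have h1 : (1 : ℝ) ≤ Ncount (k + 3) lam := by exact_mod_cast Ncount_pos (by omega) lam
    have h2 : (lam : ℝ) / (64 * (k + 1)) ≤ 1 := by
      rw [div_le_one hk]
      have : (lam : ℝ) ≤ 16 * (k + 1) := by exact_mod_cast hl.le
      linarith
    have h3 := pow_le_one₀ (n := k + 2) (by positivity) h2
    linarith
  · push Not at hl
    set Y := lam / (16 * (k + 1)) with hY
    set X := Nat.sqrt Y with hXd
    have hX1 : X ^ 2 ≤ Y := Nat.sqrt_le' Y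
    have hX2 : Y < (X + 1) ^ 2 := Nat.lt_succ_sqrt' Y
    have hY1 : 16 * (k + 1) * Y ≤ lam := Nat.mul_div_le _ _
    have hY2 : lam < 16 * (k + 1) * (Y + 1) := Nat.lt_mul_div_succ _ (by positivity)
    have hY3 : 1 ≤ Y := (Nat.one_le_div_iff (by positivity)).2 hl
    have hX3 : 1 ≤ X := Nat.sqrt_pos.2 hY3
    have h := Ncount_ge_of_sq_le (k := k) (X := X) (lam := lam)
      ((Nat.mul_le_mul_left _ hX1).trans hY1)
    have hX4 : lam ≤ 64 * (k + 1) * X ^ 2 := by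
      have : Y + 1 ≤ 4 * X ^ 2 := by nlinarith
      nlinarith [Nat.mul_le_mul_left (16 * (k + 1)) this]
    have hx : (lam : ℝ) / (64 * (k + 1)) ≤ (X : ℝ) ^ 2 := by
      rw [div_le_iff₀ hk]
      have : (lam : ℝ) ≤ 64 * (k + 1) * X ^ 2 := by exact_mod_cast hX4
      linarith
    have hl' : (lam : ℝ) / (64 * (k + 1)) ≤ lam :=
      div_le_self (by positivity) (by nlinarith [(k.cast_nonneg : (0 : ℝ) ≤ k)])
    have h' : ((X : ℝ) ^ 2) ^ (k + 1) * lam ≤ 2 * Ncount (k + 3) lam := by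
      rw [← pow_mul]; exact_mod_cast h
    have : ((lam : ℝ) / (64 * (k + 1))) ^ (k + 2) ≤ ((X : ℝ) ^ 2) ^ (k + 1) * lam := by
      rw [pow_succ]
      gcongr
    linarith

end Quaternions

/-- The lattice cube of side `2r` centred at `x`. -/
def cube {d : ℕ} (x : V d) (r : ℕ) : Finset (V d) :=
  Fintype.piFinset fun i => Finset.Icc (x i - r) (x i + r)

lemma mem_cube {d : ℕ} {x y : V d} {r : ℕ} : y ∈ cube x r ↔ ∀ i, |y i - x i| ≤ r := by
  simp only [cube, Fintype.mem_piFinset, Finset.mem_Icc, abs_le]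
  exact forall_congr' fun i => ⟨fun h => ⟨by linarith [h.1], by linarith [h.2]⟩,
    fun h => ⟨by linarith [h.1], by linarith [h.2]⟩⟩

lemma card_cube {d : ℕ} (x : V d) (r : ℕ) : (cube x r).card = (2 * r + 1) ^ d := by
  have h : ∀ i, (Finset.Icc (x i - r) (x i + r)).card = 2 * r + 1 := fun i => by
    rw [Int.card_Icc]; omega
  rw [cube, Fintype.card_piFinset, Finset.prod_congr rfl fun i _ => h i]
  simp

lemma coe_cube {d : ℕ} (x : V d) (r : ℕ) : (cube x r : Set (V d)) = Metric.closedBall x r := by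
  ext y
  rw [Finset.mem_coe, mem_cube, Metric.mem_closedBall, dist_pi_le_iff (by positivity)]
  refine forall_congr' fun i => ?_
  rw [Int.dist_eq']
  exact_mod_cast Iff.rfl

/-- The truncated dyadic maximal function. -/
def maxTrunc {d : ℕ} (K : ℕ) (g : V d → ℝ≥0∞) (x : V d) : ℝ≥0∞ :=
  ⨆ k ∈ Finset.range K, (∑ y ∈ cube x (2 ^ k), g y) / ((2 ^ k : ℕ) : ℝ≥0∞) ^ d

lemma lt_maxTrunc {d K : ℕ} {g : V d → ℝ≥0∞} {x : V d} {t : ℝ≥0∞} (h : t < maxTrunc K g x) :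
    ∃ k ∈ Finset.range K, t * ((2 ^ k : ℕ) : ℝ≥0∞) ^ d < ∑ y ∈ cube x (2 ^ k), g y := by
  simp only [maxTrunc, lt_iSup_iff] at h
  obtain ⟨k, hk, h⟩ := h
  exact ⟨k, hk, ENNReal.mul_lt_of_lt_div h⟩

/-- The weak type `(1,1)` inequality for the truncated maximal function. -/
lemma mul_count_lt_maxTrunc_le {d K : ℕ} (g : V d → ℝ≥0∞) (t : ℝ≥0∞) :
    t * Measure.count {x | t < maxTrunc K g x} ≤ 11 ^ d * ∑' y, g y := by
  classical
  set E : Set (V d) := {x | t < maxTrunc K g x} with hE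
  choose! k hkK hk using fun x (hx : x ∈ E) => lt_maxTrunc hx
  obtain ⟨u, huE, hdis, hcov⟩ := Vitali.exists_disjoint_subfamily_covering_enlargement_closedBall
    E id (fun x => ((2 ^ k x : ℕ) : ℝ)) (2 ^ K : ℕ) (fun a ha => by
      exact_mod_cast Nat.pow_le_pow_right two_pos (Finset.mem_range.1 (hkK a ha)).le) 5 (by norm_num)
  have hsub : E ⊆ ⋃ b ∈ u, (cube b (5 * 2 ^ k b) : Set (V d)) := fun x hx => by
    obtain ⟨b, hb, h⟩ := hcov x hx
    refine Set.mem_biUnion hb ?_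
    rw [coe_cube]
    push_cast at h ⊢
    exact h (Metric.mem_closedBall_self (by positivity))
  have hdis' : u.PairwiseDisjoint fun b => (cube b (2 ^ k b) : Set (V d)) := by
    intro a ha b hb hab
    change Disjoint (cube a (2 ^ k a) : Set (V d)) (cube b (2 ^ k b))
    rw [coe_cube, coe_cube]
    exact hdis ha hb hab
  have hcount : ∀ b : V d, Measure.count (cube b (5 * 2 ^ k b) : Set (V d)) ≤
      11 ^ d * ((2 ^ k b : ℕ) : ℝ≥0∞) ^ d := fun b => by
    rw [Measure.count_apply_finset, card_cube, ← mul_pow]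
    have : 2 * (5 * 2 ^ k b) + 1 ≤ 11 * 2 ^ k b := by
      have := Nat.one_le_two_pow (n := k b); omega
    exact_mod_cast Nat.pow_le_pow_left this d
  have hFubini : ∀ b : V d, ∫⁻ y in (cube b (2 ^ k b) : Set (V d)), g y ∂Measure.count =
      ∑ y ∈ cube b (2 ^ k b), g y := fun b => by
    rw [lintegral_finset]
    simp
  calc t * Measure.count E ≤ t * ∑' b : u, Measure.count (cube b.1 (5 * 2 ^ k b.1) : Set (V d)) := by
        gcongr
        exact (measure_mono hsub).trans (measure_biUnion_le _ (Set.to_countable u) _)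
    _ ≤ t * ∑' b : u, 11 ^ d * ((2 ^ k b.1 : ℕ) : ℝ≥0∞) ^ d := by
        gcongr with b
        exact hcount b
    _ = 11 ^ d * ∑' b : u, t * ((2 ^ k b.1 : ℕ) : ℝ≥0∞) ^ d := by
        rw [ENNReal.tsum_mul_left, ENNReal.tsum_mul_left]; ring
    _ ≤ 11 ^ d * ∑' b : u, ∫⁻ y in (cube b.1 (2 ^ k b.1) : Set (V d)), g y ∂Measure.count := by
        gcongr with b
        rw [hFubini]
        exact (hk b.1 (huE b.2)).le
    _ = 11 ^ d * ∫⁻ y in ⋃ b ∈ u, (cube b (2 ^ k b) : Set (V d)), g y ∂Measure.count := by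
        rw [lintegral_biUnion (Set.to_countable u) (fun _ _ => Set.Finite.measurableSet
          (Finset.finite_toSet _)) hdis']
    _ ≤ 11 ^ d * ∑' y, g y := by
        rw [← lintegral_count]
        gcongr
        exact Measure.restrict_le_self

lemma maxTrunc_le_add {d K : ℕ} (g : V d → ℝ≥0∞) (s : ℝ≥0∞) (x : V d) :
    maxTrunc K g x ≤ maxTrunc K ({y | s < g y}.indicator g) x + 3 ^ d * s := by
  classical
  refine iSup₂_le fun k hk => ?_
  refine le_trans ?_ (add_le_add_left (le_iSup₂ (f := fun k (_ : k ∈ Finset.range K) =>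
    (∑ y ∈ cube x (2 ^ k), {y | s < g y}.indicator g y) / ((2 ^ k : ℕ) : ℝ≥0∞) ^ d) k hk) _)
  have h2 : ((2 ^ k : ℕ) : ℝ≥0∞) ^ d ≠ 0 := by simp
  have h2' : ((2 ^ k : ℕ) : ℝ≥0∞) ^ d ≠ ⊤ := by simp
  rw [ENNReal.div_le_iff h2 h2', add_mul, ENNReal.div_mul_cancel h2 h2']
  have h : ∀ y, g y ≤ {y | s < g y}.indicator g y + s := fun y => by
    by_cases hy : s < g y
    · rw [Set.indicator_of_mem (by exact hy)]; exact le_self_add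
    · rw [Set.indicator_of_notMem (by exact hy), zero_add]; exact not_lt.1 hy
  refine (Finset.sum_le_sum fun y _ => h y).trans ?_
  rw [Finset.sum_add_distrib, Finset.sum_const, card_cube, nsmul_eq_mul]
  refine add_le_add le_rfl ?_
  rw [mul_right_comm, ← mul_pow]
  gcongr
  have : 2 * 2 ^ k + 1 ≤ 3 * 2 ^ k := by
    have := Nat.one_le_two_pow (n := k); omega
  exact_mod_cast Nat.pow_le_pow_left this d

lemma count_lt_maxTrunc_le {d K : ℕ} (g : V d → ℝ≥0∞) {t : ℝ≥0∞} (ht : t ≠ 0) (ht' : t ≠ ⊤) :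
    Measure.count {x | t < maxTrunc K g x} ≤
      2 * 11 ^ d * t⁻¹ * ∑' y, {y | t < 2 * 3 ^ d * g y}.indicator g y := by
  have ha : (2 * 3 ^ d : ℝ≥0∞) ≠ 0 := by simp
  have ha' : (2 * 3 ^ d : ℝ≥0∞) ≠ ⊤ := by finiteness
  set s := t / (2 * 3 ^ d) with hs
  have hset : {y | t < 2 * 3 ^ d * g y} = {y | s < g y} := by
    ext y
    simp only [Set.mem_ofPred_eq]
    rw [hs, ENNReal.div_lt_iff (Or.inl ha) (Or.inl ha'), mul_comm]
  have hs3 : 3 ^ d * s = t / 2 := by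
    rw [hs, div_eq_mul_inv, ENNReal.mul_inv (by simp) (by simp), div_eq_mul_inv]
    rw [show (3 : ℝ≥0∞) ^ d * (t * (2⁻¹ * (3 ^ d)⁻¹)) = t * 2⁻¹ * (3 ^ d * (3 ^ d)⁻¹) by ring,
      ENNReal.mul_inv_cancel (by simp) (by finiteness), mul_one]
  have hsub : {x | t < maxTrunc K g x} ⊆ {x | t / 2 < maxTrunc K ({y | s < g y}.indicator g) x} := by
    intro x hx
    have hx : t < maxTrunc K g x := hx
    have h := hx.trans_le (maxTrunc_le_add g s x)
    rw [hs3] at h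
    by_contra hcon
    have hcon : maxTrunc K ({y | s < g y}.indicator g) x ≤ t / 2 := not_lt.1 hcon
    refine absurd h (not_lt.2 ((add_le_add_left hcon _).trans ?_))
    rw [ENNReal.add_halves]
  rw [hset]
  refine (measure_mono hsub).trans ?_
  have h := mul_count_lt_maxTrunc_le (K := K) ({y | s < g y}.indicator g) (t / 2)
  have ht2 : t / 2 ≠ 0 := by simp [ht]
  have ht2' : t / 2 ≠ ⊤ := by finiteness
  rw [mul_comm, ← ENNReal.le_div_iff_mul_le (Or.inl ht2) (Or.inl ht2')] at h
  refine h.trans (le_of_eq ?_)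
  rw [div_eq_mul_inv, ENNReal.inv_div (by simp) (by simp), div_eq_mul_inv]
  ring

lemma lintegral_Ioc_rpow {r A : ℝ} (hr : -1 < r) (hA : 0 ≤ A) :
    ∫⁻ t in Set.Ioc 0 A, ENNReal.ofReal (t ^ r) = ENNReal.ofReal (A ^ (r + 1) / (r + 1)) := by
  have hi : IntegrableOn (fun t : ℝ => t ^ r) (Set.Ioc 0 A) :=
    (intervalIntegrable_iff_integrableOn_Ioc_of_le hA).1
      (intervalIntegral.intervalIntegrable_rpow' hr)
  rw [← ofReal_integral_eq_lintegral_ofReal hi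
    ((ae_restrict_iff' measurableSet_Ioc).2 (ae_of_all _ fun t ht => Real.rpow_nonneg ht.1.le r)),
    ← intervalIntegral.integral_of_le hA, integral_rpow (Or.inl hr),
    Real.zero_rpow (by linarith), sub_zero]

lemma maxTrunc_ne_top {d K : ℕ} {g : V d → ℝ≥0∞} (hg : ∀ y, g y ≠ ⊤) (x : V d) :
    maxTrunc K g x ≠ ⊤ := by
  have : maxTrunc K g x ≤
      ∑ k ∈ Finset.range K, (∑ y ∈ cube x (2 ^ k), g y) / ((2 ^ k : ℕ) : ℝ≥0∞) ^ d :=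
    iSup₂_le fun k hk => Finset.single_le_sum
      (f := fun k => (∑ y ∈ cube x (2 ^ k), g y) / ((2 ^ k : ℕ) : ℝ≥0∞) ^ d)
      (fun _ _ => zero_le) hk
  refine ne_top_of_le_ne_top (ENNReal.sum_ne_top.2 fun k _ => ENNReal.div_ne_top
    (ENNReal.sum_ne_top.2 fun y _ => hg y) (by simp)) this

lemma measurable_of_lattice {d : ℕ} {β : Type*} [MeasurableSpace β] (f : V d → β) :
    Measurable f := measurable_of_countable f

lemma tsum_maxTrunc_rpow_le (d : ℕ) {p : ℝ} (hp : 1 < p) (K : ℕ) {g : V d → ℝ≥0∞}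
    (hg : ∀ y, g y ≠ ⊤) :
    ∑' x, maxTrunc K g x ^ p ≤
      ENNReal.ofReal p * (2 * 11 ^ d * ENNReal.ofReal ((2 * 3 ^ d) ^ (p - 1) / (p - 1))) *
        ∑' y, g y ^ p := by
  have hp0 : 0 < p := by linarith
  have hp1 : 0 < p - 1 := by linarith
  set a : ℝ := 2 * 3 ^ d with ha
  have ha0 : 0 < a := by positivity
  have haE : ENNReal.ofReal a = 2 * 3 ^ d := by
    rw [ha, ENNReal.ofReal_mul (by norm_num), ENNReal.ofReal_pow (by norm_num)]
    simp
  have key : ∀ t ∈ Set.Ioi (0 : ℝ), Measure.count {x | t < (maxTrunc K g x).toReal} *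
      ENNReal.ofReal (t ^ (p - 1)) ≤ ∑' y, 2 * 11 ^ d * (g y *
        (Set.Ioc 0 (a * (g y).toReal)).indicator (fun t => ENNReal.ofReal (t ^ (p - 2))) t) := by
    intro t ht
    have ht : 0 < t := ht
    have hset : {x | t < (maxTrunc K g x).toReal} = {x | ENNReal.ofReal t < maxTrunc K g x} := by
      ext x
      exact (ENNReal.ofReal_lt_iff_lt_toReal ht.le (maxTrunc_ne_top hg x)).symm
    have hpow : (ENNReal.ofReal t)⁻¹ * ENNReal.ofReal (t ^ (p - 1)) =
        ENNReal.ofReal (t ^ (p - 2)) := by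
      rw [← ENNReal.ofReal_inv_of_pos ht, ← ENNReal.ofReal_mul (by positivity)]
      congr 1
      rw [show p - 1 = (p - 2) + 1 by ring, Real.rpow_add_one ht.ne']
      field_simp
    rw [hset]
    refine (mul_le_mul_left (count_lt_maxTrunc_le g (ENNReal.ofReal_pos.2 ht).ne'
      ENNReal.ofReal_ne_top) _).trans ?_
    rw [mul_right_comm, mul_assoc (2 * 11 ^ d), hpow, mul_assoc, ENNReal.tsum_mul_left,
      ← ENNReal.tsum_mul_left]
    refine mul_le_mul_right (ENNReal.tsum_le_tsum fun y => ?_) _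
    by_cases hy : ENNReal.ofReal t < 2 * 3 ^ d * g y
    · have hmem : t ∈ Set.Ioc 0 (a * (g y).toReal) := by
        refine ⟨ht, ?_⟩
        rw [← haE, ENNReal.ofReal_lt_iff_lt_toReal ht.le (ENNReal.mul_ne_top ENNReal.ofReal_ne_top
          (hg y)), ENNReal.toReal_mul, ENNReal.toReal_ofReal ha0.le] at hy
        exact hy.le
      rw [Set.indicator_of_mem (by exact hy), Set.indicator_of_mem hmem, mul_comm]
    · rw [Set.indicator_of_notMem (by exact hy), mul_zero]
      exact zero_le
  have hFubini : ∀ y, ∫⁻ t in Set.Ioi (0 : ℝ), 2 * 11 ^ d * (g y *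
        (Set.Ioc 0 (a * (g y).toReal)).indicator (fun t => ENNReal.ofReal (t ^ (p - 2))) t) =
      2 * 11 ^ d * ENNReal.ofReal (a ^ (p - 1) / (p - 1)) * g y ^ p := by
    intro y
    have hm : Measurable fun t : ℝ =>
        (Set.Ioc 0 (a * (g y).toReal)).indicator (fun t => ENNReal.ofReal (t ^ (p - 2))) t :=
      (by fun_prop : Measurable fun t : ℝ => ENNReal.ofReal (t ^ (p - 2))).indicator
        measurableSet_Ioc
    rw [lintegral_const_mul _ (hm.const_mul _), lintegral_const_mul _ hm,
      lintegral_indicator measurableSet_Ioc, Measure.restrict_restrict measurableSet_Ioc,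
      Set.inter_eq_self_of_subset_left (fun t ht => ht.1), lintegral_Ioc_rpow (by linarith)
      (by positivity), show p - 2 + 1 = p - 1 by ring, Real.mul_rpow ha0.le (by positivity),
      mul_div_right_comm, ENNReal.ofReal_mul (by positivity), mul_assoc (2 * 11 ^ d)]
    congr 1
    rw [mul_left_comm]
    congr 1
    rw [← ENNReal.ofReal_rpow_of_nonneg (by positivity) hp1.le, ENNReal.ofReal_toReal (hg y)]
    conv_rhs => rw [show p = 1 + (p - 1) by ring]
    rw [ENNReal.rpow_add_of_nonneg _ _ zero_le_one hp1.le, ENNReal.rpow_one]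
  calc ∑' x, maxTrunc K g x ^ p
      = ∫⁻ x, ENNReal.ofReal ((maxTrunc K g x).toReal ^ p) ∂Measure.count := by
        rw [lintegral_count]
        refine tsum_congr fun x => ?_
        rw [← ENNReal.ofReal_rpow_of_nonneg (by positivity) hp0.le,
          ENNReal.ofReal_toReal (maxTrunc_ne_top hg x)]
    _ = ENNReal.ofReal p * ∫⁻ t in Set.Ioi 0, Measure.count {x | t < (maxTrunc K g x).toReal} *
          ENNReal.ofReal (t ^ (p - 1)) :=
        lintegral_rpow_eq_lintegral_meas_lt_mul _ (ae_of_all _ fun x => ENNReal.toReal_nonneg)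
          (measurable_of_lattice _).aemeasurable hp0
    _ ≤ ENNReal.ofReal p * ∫⁻ t in Set.Ioi (0 : ℝ), ∑' y, 2 * 11 ^ d * (g y *
        (Set.Ioc 0 (a * (g y).toReal)).indicator (fun t => ENNReal.ofReal (t ^ (p - 2))) t) := by
        exact mul_le_mul_right (setLIntegral_mono' measurableSet_Ioi key) _
    _ = _ := by
        rw [lintegral_tsum, tsum_congr hFubini, ENNReal.tsum_mul_left]
        · ring
        intro y
        refine Measurable.aemeasurable (Measurable.const_mul (Measurable.const_mul ?_ _) _)
        exact (by fun_prop : Measurable fun t : ℝ => ENNReal.ofReal (t ^ (p - 2))).indicator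
          measurableSet_Ioc

/-- The dyadic Hardy–Littlewood maximal function on the lattice. -/
def maxHL {d : ℕ} (g : V d → ℝ≥0∞) (x : V d) : ℝ≥0∞ :=
  ⨆ k : ℕ, (∑ y ∈ cube x (2 ^ k), g y) / ((2 ^ k : ℕ) : ℝ≥0∞) ^ d

lemma maxHL_eq_iSup {d : ℕ} (g : V d → ℝ≥0∞) (x : V d) :
    maxHL g x = ⨆ K, maxTrunc K g x := by
  refine le_antisymm (iSup_le fun k => ?_) (iSup_le fun K => iSup₂_le fun k _ =>
    le_iSup (fun k : ℕ => (∑ y ∈ cube x (2 ^ k), g y) / ((2 ^ k : ℕ) : ℝ≥0∞) ^ d) k)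
  refine le_trans ?_ (le_iSup (fun K => maxTrunc K g x) (k + 1))
  exact le_iSup₂_of_le k (Finset.self_mem_range_succ k) le_rfl

lemma monotone_maxTrunc {d : ℕ} (g : V d → ℝ≥0∞) (x : V d) :
    Monotone fun K => maxTrunc K g x := fun _ _ h =>
  biSup_mono fun _ hk => Finset.range_mono h hk

/-- The Hardy–Littlewood maximal theorem on the lattice. -/
lemma exists_tsum_maxHL_rpow_le (d : ℕ) {p : ℝ} (hp : 1 < p) :
    ∃ C : ℝ≥0, ∀ g : V d → ℝ≥0∞, (∀ y, g y ≠ ⊤) →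
      ∑' x, maxHL g x ^ p ≤ C * ∑' y, g y ^ p := by
  have hp0 : 0 < p := by linarith
  have hC : ENNReal.ofReal p *
      (2 * 11 ^ d * ENNReal.ofReal ((2 * 3 ^ d) ^ (p - 1) / (p - 1))) ≠ ⊤ := by finiteness
  refine ⟨_, fun g hg => le_of_le_of_eq ?_ (congrArg (· * _) (ENNReal.coe_toNNReal hC).symm)⟩
  have h : ∀ x, maxHL g x ^ p = ⨆ K, maxTrunc K g x ^ p := fun x => by
    rw [maxHL_eq_iSup]
    exact (ENNReal.orderIsoRpow p hp0).map_iSup _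
  rw [tsum_congr h, ← lintegral_count, lintegral_iSup (fun _ => measurable_of_lattice _)
    (fun _ _ hK x => ENNReal.rpow_le_rpow (monotone_maxTrunc g x hK) hp0.le)]
  refine iSup_le fun K => ?_
  rw [lintegral_count]
  exact tsum_maxTrunc_rpow_le d hp K hg

lemma eC_add (a b : ℝ) : eC (a + b) = eC a * eC b := by
  rw [eC, eC, eC, ← Complex.exp_add]
  push_cast
  ring_nf

lemma eC_zero : eC 0 = 1 := by simp [eC]

lemma norm_eC (a : ℝ) : ‖eC a‖ = 1 := by
  rw [eC, show (2 * Real.pi * Complex.I * a : ℂ) = ((2 * Real.pi * a : ℝ) : ℂ) * Complex.I by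
    push_cast; ring]
  exact Complex.norm_exp_ofReal_mul_I _

lemma eC_neg (a : ℝ) : eC (-a) = starRingEnd ℂ (eC a) := by
  rw [eC, eC, ← Complex.exp_conj]
  congr 1
  have : starRingEnd ℂ 2 = 2 := Complex.conj_ofNat 2
  simp [this]

lemma eC_intCast (m : ℤ) : eC m = 1 := by
  rw [eC, show (2 * Real.pi * Complex.I * (m : ℝ) : ℂ) = m * (2 * Real.pi * Complex.I) by
    push_cast; ring]
  exact Complex.exp_int_mul_two_pi_mul_I m

lemma continuous_eC : Continuous eC := by
  unfold eC
  fun_prop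

lemma eC_sum {ι : Type*} (s : Finset ι) (g : ι → ℝ) : eC (∑ i ∈ s, g i) = ∏ i ∈ s, eC (g i) := by
  classical
  induction s using Finset.induction_on with
  | empty => simp [eC_zero]
  | insert a s ha ih => rw [Finset.sum_insert ha, Finset.prod_insert ha, eC_add, ih]

/-- The distance to the nearest integer. -/
def distInt (t : ℝ) : ℝ := |t - round t|

lemma distInt_nonneg (t : ℝ) : 0 ≤ distInt t := abs_nonneg _

lemma distInt_le (t : ℝ) (m : ℤ) : distInt t ≤ |t - m| := round_le t m

lemma distInt_le_half (t : ℝ) : distInt t ≤ 1 / 2 := abs_sub_round t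

lemma four_mul_distInt_le (t : ℝ) : 4 * distInt t ≤ ‖eC t - 1‖ := by
  have h1 : eC t = eC (t - round t) := by
    conv_lhs => rw [show t = (t - round t) + (round t : ℤ) by ring, eC_add, eC_intCast, mul_one]
  set x := t - round t with hx
  have hx2 : |x| ≤ 1 / 2 := abs_sub_round t
  rw [h1, distInt, ← hx, eC, show (2 * Real.pi * Complex.I * x : ℂ) =
    Complex.I * ((2 * Real.pi * x : ℝ) : ℂ) by push_cast; ring,
    Complex.norm_exp_I_mul_ofReal_sub_one, norm_mul, Real.norm_eq_abs, Real.norm_eq_abs, abs_two]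
  have h2 := Real.mul_abs_le_abs_sin (x := Real.pi * x) (by
    rw [abs_mul, abs_of_pos Real.pi_pos]
    nlinarith [Real.pi_pos])
  rw [abs_mul, abs_of_pos Real.pi_pos] at h2
  have h3 : 2 / Real.pi * (Real.pi * |x|) = 2 * |x| := by
    have := Real.pi_ne_zero
    field_simp
  rw [show 2 * Real.pi * x / 2 = Real.pi * x by ring]
  linarith

lemma sum_Icc_telescope (g : ℤ → ℂ) (a : ℤ) (m : ℕ) :
    ∑ y ∈ Finset.Icc a (a + m), (g (y + 1) - g y) = g (a + m + 1) - g a := by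
  induction m with
  | zero => simp
  | succ m ih =>
    have : Finset.Icc a (a + (m + 1 : ℕ)) = insert (a + m + 1) (Finset.Icc a (a + m)) := by
      ext y
      simp only [Finset.mem_Icc, Finset.mem_insert]
      push_cast
      omega
    rw [this, Finset.sum_insert (by simp only [Finset.mem_Icc]; omega), ih]
    push_cast
    ring_nf

/-- The majorant for incomplete geometric sums of length at most `A`. -/
def geomMaj (A t : ℝ) : ℝ := 2 * A / (1 + 2 * A * distInt t)

lemma geomMaj_nonneg {A : ℝ} (hA : 0 ≤ A) (t : ℝ) : 0 ≤ geomMaj A t := by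
  have := distInt_nonneg t
  unfold geomMaj
  positivity

lemma norm_geom_sum_le (t : ℝ) {n : ℕ} {a b : ℤ} (hab : b - a ≤ n) :
    ‖∑ y ∈ Finset.Icc a b, eC (t * y)‖ ≤ geomMaj (n + 1) t := by
  by_cases hle : a ≤ b
  swap
  · rw [Finset.Icc_eq_empty hle, Finset.sum_empty, norm_zero]
    exact geomMaj_nonneg (by positivity) t
  obtain ⟨m, hm⟩ := Int.eq_ofNat_of_zero_le (sub_nonneg.2 hle)
  have hb : b = a + m := by omega
  subst hb
  set S := ∑ y ∈ Finset.Icc a (a + m), eC (t * y) with hS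
  have h1 : ‖S‖ ≤ n + 1 := by
    refine (norm_sum_le _ _).trans ?_
    simp only [norm_eC, Finset.sum_const, nsmul_eq_mul, mul_one, Int.card_Icc]
    have : ((a + m + 1 - a).toNat : ℤ) ≤ n + 1 := by omega
    exact_mod_cast this
  have h2 : ‖S‖ * ‖eC t - 1‖ ≤ 2 := by
    rw [← norm_mul, hS, Finset.sum_mul]
    have : ∀ y ∈ Finset.Icc a (a + m), eC (t * y) * (eC t - 1) =
        eC (t * ((y + 1 : ℤ) : ℝ)) - eC (t * y) := fun y _ => by
      rw [mul_sub, mul_one, ← eC_add]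
      push_cast
      ring_nf
    rw [Finset.sum_congr rfl this, sum_Icc_telescope (fun y => eC (t * y))]
    refine (norm_sub_le _ _).trans ?_
    rw [norm_eC, norm_eC]
    norm_num
  have h3 := four_mul_distInt_le t
  have h4 := distInt_nonneg t
  rw [geomMaj, le_div_iff₀ (by positivity)]
  have h5 : ‖S‖ * (4 * distInt t) ≤ 2 :=
    (mul_le_mul_of_nonneg_left h3 (norm_nonneg _)).trans h2
  nlinarith [norm_nonneg S, (by positivity : (0 : ℝ) ≤ n + 1)]

/-- The `TT*` bound for finite matrices. -/
lemma sum_norm_sq_le_of_gram {α β : Type*} (X : Finset α) (Y : Finset β) (M : α → β → ℂ) {R : ℝ}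
    (hR0 : 0 ≤ R)
    (hR : ∀ x ∈ X, ∑ x' ∈ X, ‖∑ y ∈ Y, M x y * starRingEnd ℂ (M x' y)‖ ≤ R) (f : β → ℂ) :
    ∑ x ∈ X, ‖∑ y ∈ Y, M x y * f y‖ ^ 2 ≤ R * ∑ y ∈ Y, ‖f y‖ ^ 2 := by
  set g : α → ℂ := fun x => starRingEnd ℂ (∑ y ∈ Y, M x y * f y) with hg
  set G : α → α → ℝ := fun x x' => ‖∑ y ∈ Y, M x y * starRingEnd ℂ (M x' y)‖ with hG
  have hGsymm : ∀ x x', G x x' = G x' x := fun x x' => by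
    simp only [hG]
    rw [← RCLike.norm_conj, map_sum]
    congr 1
    refine Finset.sum_congr rfl fun y _ => ?_
    simp [mul_comm]
  set S := ∑ x ∈ X, ‖∑ y ∈ Y, M x y * f y‖ ^ 2 with hS
  have hgS : ∑ x ∈ X, ‖g x‖ ^ 2 = S := by simp only [hg, RCLike.norm_conj, hS]
  set F := ∑ y ∈ Y, ‖f y‖ ^ 2 with hF
  have hS0 : 0 ≤ S := Finset.sum_nonneg fun x _ => by positivity
  have hF0 : 0 ≤ F := Finset.sum_nonneg fun x _ => by positivity
  have e1 : (S : ℂ) = ∑ y ∈ Y, f y * ∑ x ∈ X, g x * M x y := by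
    have : ∀ x ∈ X, ((‖∑ y ∈ Y, M x y * f y‖ ^ 2 : ℝ) : ℂ) = ∑ y ∈ Y, f y * (g x * M x y) :=
      fun x _ => by
        push_cast
        rw [← Complex.conj_mul', Finset.mul_sum]
        exact Finset.sum_congr rfl fun y _ => by ring
    rw [hS, Complex.ofReal_sum, Finset.sum_congr rfl this, Finset.sum_comm]
    exact Finset.sum_congr rfl fun y _ => by rw [Finset.mul_sum]
  have e2 : ∑ y ∈ Y, ‖∑ x ∈ X, g x * M x y‖ ^ 2 ≤ R * S := by
    have h1 : ((∑ y ∈ Y, ‖∑ x ∈ X, g x * M x y‖ ^ 2 : ℝ) : ℂ) =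
        ∑ x ∈ X, ∑ x' ∈ X, (g x * starRingEnd ℂ (g x')) *
          ∑ y ∈ Y, M x y * starRingEnd ℂ (M x' y) := by
      push_cast
      have : ∀ y ∈ Y, ((‖∑ x ∈ X, g x * M x y‖ : ℝ) : ℂ) ^ 2 = ∑ x ∈ X, ∑ x' ∈ X,
          (g x * starRingEnd ℂ (g x')) * (M x y * starRingEnd ℂ (M x' y)) := fun y _ => by
        rw [← Complex.mul_conj', map_sum, Finset.sum_mul_sum]
        refine Finset.sum_congr rfl fun x _ => Finset.sum_congr rfl fun x' _ => ?_
        rw [map_mul]; ring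
      rw [Finset.sum_congr rfl this, Finset.sum_comm]
      refine Finset.sum_congr rfl fun x _ => ?_
      rw [Finset.sum_comm]
      exact Finset.sum_congr rfl fun x' _ => by rw [Finset.mul_sum]
    have h2 : ∑ y ∈ Y, ‖∑ x ∈ X, g x * M x y‖ ^ 2 ≤ ∑ x ∈ X, ∑ x' ∈ X, ‖g x‖ * ‖g x'‖ * G x x' := by
      have h0 : 0 ≤ ∑ y ∈ Y, ‖∑ x ∈ X, g x * M x y‖ ^ 2 :=
        Finset.sum_nonneg fun x _ => by positivity
      rw [← Complex.norm_of_nonneg h0, h1]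
      refine (norm_sum_le _ _).trans (Finset.sum_le_sum fun x _ => ?_)
      refine (norm_sum_le _ _).trans (Finset.sum_le_sum fun x' _ => ?_)
      rw [norm_mul, norm_mul, RCLike.norm_conj (g x')]
    have h3 : ∑ x ∈ X, ∑ x' ∈ X, ‖g x‖ ^ 2 * G x x' ≤ R * S := by
      rw [← hgS, Finset.mul_sum]
      refine Finset.sum_le_sum fun x hx => ?_
      rw [← Finset.mul_sum, mul_comm]
      exact mul_le_mul_of_nonneg_right (hR x hx) (by positivity)
    have h4 : ∑ x ∈ X, ∑ x' ∈ X, ‖g x'‖ ^ 2 * G x x' = ∑ x ∈ X, ∑ x' ∈ X, ‖g x‖ ^ 2 * G x x' := by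
      rw [Finset.sum_comm]
      exact Finset.sum_congr rfl fun x _ => Finset.sum_congr rfl fun x' _ => by rw [hGsymm]
    have h5 : ∑ x ∈ X, ∑ x' ∈ X, ‖g x‖ * ‖g x'‖ * G x x' ≤
        ∑ x ∈ X, ∑ x' ∈ X, (‖g x‖ ^ 2 * G x x' / 2 + ‖g x'‖ ^ 2 * G x x' / 2) :=
      Finset.sum_le_sum fun x _ => Finset.sum_le_sum fun x' _ => by
        have : 0 ≤ G x x' := norm_nonneg _
        nlinarith [mul_nonneg (sq_nonneg (‖g x‖ - ‖g x'‖)) this]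
    simp only [Finset.sum_add_distrib, ← Finset.sum_div] at h5
    linarith
  have e3 : S ^ 2 ≤ F * (R * S) := by
    have h1 : S ≤ ∑ y ∈ Y, ‖f y‖ * ‖∑ x ∈ X, g x * M x y‖ := by
      rw [← Complex.norm_of_nonneg hS0, e1]
      refine (norm_sum_le _ _).trans (Finset.sum_le_sum fun y _ => ?_)
      rw [norm_mul]
    refine (pow_le_pow_left₀ hS0 h1 2).trans ((Finset.sum_mul_sq_le_sq_mul_sq _ _ _).trans ?_)
    exact mul_le_mul_of_nonneg_left e2 hF0
  rcases hS0.eq_or_lt with h0 | h0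
  · rw [← h0]
    positivity
  · nlinarith

/-- The lattice box `[0, n]^d`. -/
def nbox (d n : ℕ) : Finset (V d) := Fintype.piFinset fun _ => Finset.Icc (0 : ℤ) n

/-- The lattice box `[-n, n]^d`. -/
def symBox (d n : ℕ) : Finset (V d) :=
  Fintype.piFinset fun _ => Finset.Icc (-n : ℤ) n

lemma card_nbox (d n : ℕ) : (nbox d n).card = (n + 1) ^ d := by
  rw [nbox, Fintype.card_piFinset_const, Int.card_Icc]
  simp

lemma card_symBox (d n : ℕ) : (symBox d n).card = (2 * n + 1) ^ d := by
  rw [symBox, Fintype.card_piFinset_const, Int.card_Icc]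
  congr 1
  omega

/-- The operator with kernel `e(θ |u|²)` on the box `[0, n]^d`. -/
def weylOp (d n : ℕ) (θ : ℝ) (f : V d → ℂ) (x : V d) : ℂ :=
  ∑ u ∈ nbox d n, eC (θ * ∑ i, (u i : ℝ) ^ 2) * f (x - u)

/-- The quadratic Weyl sum. -/
def weylSum (n : ℕ) (θ : ℝ) : ℂ := ∑ v ∈ Finset.Icc (0 : ℤ) n, eC (θ * (v : ℝ) ^ 2)

/-- The row sum bound for the Gram matrix of the Weyl kernel. -/
def gramSum (n : ℕ) (θ : ℝ) : ℝ :=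
  ∑ h ∈ Finset.Icc (-n : ℤ) n, geomMaj (n + 1) (2 * θ * h)

lemma gramSum_nonneg (n : ℕ) (θ : ℝ) : 0 ≤ gramSum n θ :=
  Finset.sum_nonneg fun _ _ => geomMaj_nonneg (by positivity) _

/-- The one-dimensional Weyl kernel. -/
def weylKer (n : ℕ) (θ : ℝ) (a b : ℤ) : ℂ :=
  if a - b ∈ Finset.Icc (0 : ℤ) n then eC (θ * ((a - b : ℤ) : ℝ) ^ 2) else 0

lemma norm_gram_weylKer_le {n : ℕ} (θ : ℝ) {a a' : ℤ} (ha : a ∈ Finset.Icc (0 : ℤ) n)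
    (ha' : a' ∈ Finset.Icc (0 : ℤ) n) :
    ‖∑ b ∈ Finset.Icc (-n : ℤ) n, weylKer n θ a b * starRingEnd ℂ (weylKer n θ a' b)‖ ≤
      geomMaj (n + 1) (2 * θ * ((a' - a : ℤ) : ℝ)) := by
  rw [Finset.mem_Icc] at ha ha'
  have hsub : Finset.Icc (max a a' - n) (min a a') ⊆ Finset.Icc (-n : ℤ) n := by
    intro b hb
    simp only [Finset.mem_Icc] at hb ⊢
    omega
  rw [← Finset.sum_subset hsub]
  · have h : ∀ b ∈ Finset.Icc (max a a' - n) (min a a'),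
        weylKer n θ a b * starRingEnd ℂ (weylKer n θ a' b) =
        eC (θ * ((a : ℝ) ^ 2 - (a' : ℝ) ^ 2)) * eC (2 * θ * ((a' - a : ℤ) : ℝ) * b) := by
      intro b hb
      rw [Finset.mem_Icc] at hb
      rw [weylKer, weylKer, if_pos (by rw [Finset.mem_Icc]; omega),
        if_pos (by rw [Finset.mem_Icc]; omega), ← eC_neg, ← eC_add, ← eC_add]
      congr 1
      push_cast
      ring
    rw [Finset.sum_congr rfl h, ← Finset.mul_sum, norm_mul, norm_eC, one_mul]
    exact norm_geom_sum_le _ (by omega)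
  · intro b _ hb
    rw [Finset.mem_Icc] at hb
    rw [weylKer, weylKer]
    by_cases h : a - b ∈ Finset.Icc (0 : ℤ) n
    · rw [if_neg (c := a' - b ∈ _), map_zero, mul_zero]
      rw [Finset.mem_Icc] at h ⊢
      omega
    · rw [if_neg h, zero_mul]

lemma sum_geomMaj_le_gramSum {n : ℕ} (θ : ℝ) {a : ℤ} (ha : a ∈ Finset.Icc (0 : ℤ) n) :
    ∑ a' ∈ Finset.Icc (0 : ℤ) n, geomMaj (n + 1) (2 * θ * ((a' - a : ℤ) : ℝ)) ≤ gramSum n θ := by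
  rw [Finset.mem_Icc] at ha
  have : ∑ a' ∈ Finset.Icc (0 : ℤ) n, geomMaj (n + 1) (2 * θ * ((a' - a : ℤ) : ℝ)) =
      ∑ h ∈ (Finset.Icc (0 : ℤ) n).image (fun a' => a' - a), geomMaj (n + 1) (2 * θ * h) := by
    rw [Finset.sum_image]
    intro x _ y _ h
    simpa using h
  rw [this]
  refine Finset.sum_le_sum_of_subset_of_nonneg ?_ fun _ _ _ => geomMaj_nonneg (by positivity) _
  intro h hh
  simp only [Finset.mem_image, Finset.mem_Icc] at hh ⊢
  omega

lemma weylOp_eq_sum_weylKer {d n : ℕ} (θ : ℝ) (f : V d → ℂ) {r : V d} (hr : r ∈ nbox d n) :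
    weylOp d n θ f r = ∑ y ∈ symBox d n, (∏ i, weylKer n θ (r i) (y i)) * f y := by
  simp only [nbox, Fintype.mem_piFinset, Finset.mem_Icc] at hr
  have h1 : weylOp d n θ f r =
      ∑ y ∈ (nbox d n).image (fun u => r - u), (∏ i, weylKer n θ (r i) (y i)) * f y := by
    rw [Finset.sum_image (fun x _ y _ h => sub_right_injective h), weylOp]
    refine Finset.sum_congr rfl fun u hu => ?_
    simp only [nbox, Fintype.mem_piFinset] at hu
    congr 1
    rw [Finset.mul_sum, eC_sum]
    refine Finset.prod_congr rfl fun i _ => ?_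
    have : r i - (r - u) i = u i := sub_sub_cancel _ _
    rw [weylKer, this, if_pos (hu i)]
  rw [h1]
  refine Finset.sum_subset ?_ ?_
  · intro y hy
    simp only [Finset.mem_image, nbox, symBox, Fintype.mem_piFinset, Finset.mem_Icc] at hy ⊢
    obtain ⟨u, hu, rfl⟩ := hy
    intro i
    have := hu i
    have := hr i
    simp only [Pi.sub_apply]
    omega
  · intro y _ hy
    have : ∃ i, r i - y i ∉ Finset.Icc (0 : ℤ) n := by
      by_contra hcon
      push Not at hcon
      refine hy (Finset.mem_image.2 ⟨r - y, ?_, sub_sub_cancel _ _⟩)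
      exact Fintype.mem_piFinset.2 hcon
    obtain ⟨i, hi⟩ := this
    rw [Finset.prod_eq_zero (Finset.mem_univ i) (by rw [weylKer, if_neg hi]), zero_mul]

/-- Local `ℓ²` bound for the Weyl operator. -/
lemma sum_norm_sq_weylOp_le (d n : ℕ) (θ : ℝ) (f : V d → ℂ) :
    ∑ r ∈ nbox d n, ‖weylOp d n θ f r‖ ^ 2 ≤
      gramSum n θ ^ d * ∑ y ∈ symBox d n, ‖f y‖ ^ 2 := by
  rw [Finset.sum_congr rfl fun r hr => by rw [weylOp_eq_sum_weylKer θ f hr]]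
  refine sum_norm_sq_le_of_gram (nbox d n) (symBox d n)
    (fun x y => ∏ i, weylKer n θ (x i) (y i)) (pow_nonneg (gramSum_nonneg n θ) d) ?_ f
  intro x hx
  simp only [nbox, Fintype.mem_piFinset] at hx
  have h1 : ∀ x' ∈ nbox d n, ‖∑ y ∈ symBox d n, (∏ i, weylKer n θ (x i) (y i)) *
      starRingEnd ℂ (∏ i, weylKer n θ (x' i) (y i))‖ ≤
      ∏ i, geomMaj (n + 1) (2 * θ * ((x' i - x i : ℤ) : ℝ)) := by
    intro x' hx'
    simp only [nbox, Fintype.mem_piFinset] at hx'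
    have : ∑ y ∈ symBox d n, (∏ i, weylKer n θ (x i) (y i)) *
        starRingEnd ℂ (∏ i, weylKer n θ (x' i) (y i)) =
        ∏ i, ∑ b ∈ Finset.Icc (-n : ℤ) n,
          weylKer n θ (x i) b * starRingEnd ℂ (weylKer n θ (x' i) b) := by
      rw [Finset.prod_univ_sum, symBox]
      refine Finset.sum_congr rfl fun y _ => ?_
      rw [map_prod, Finset.prod_mul_distrib]
    rw [this, norm_prod]
    exact Finset.prod_le_prod (fun _ _ => norm_nonneg _) fun i _ =>
      norm_gram_weylKer_le θ (hx i) (hx' i)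
  refine (Finset.sum_le_sum h1).trans ?_
  rw [nbox, ← Finset.prod_univ_sum (fun _ => Finset.Icc (0 : ℤ) n)
    (fun i a' => geomMaj (n + 1) (2 * θ * ((a' - x i : ℤ) : ℝ)))]
  refine (Finset.prod_le_prod (fun _ _ => Finset.sum_nonneg fun _ _ =>
    geomMaj_nonneg (by positivity) _) fun i _ => sum_geomMaj_le_gramSum θ (hx i)).trans ?_
  simp

/-- The Weyl inequality in terms of the Gram row sum. -/
lemma norm_weylSum_sq_le (n : ℕ) (θ : ℝ) : ‖weylSum n θ‖ ^ 2 ≤ 2 * gramSum n θ := by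
  have hT : ∀ r, weylOp 1 n θ (fun _ => 1) r = weylSum n θ := fun r => by
    have h := Finset.prod_univ_sum (ι := Fin 1) (fun _ => Finset.Icc (0 : ℤ) n)
      (fun _ v => eC (θ * (v : ℝ) ^ 2))
    simp only [Fin.prod_univ_one] at h
    rw [weylOp, weylSum, h, nbox]
    simp
  have h := sum_norm_sq_weylOp_le 1 n θ (fun _ => 1)
  simp only [hT, Finset.sum_const, card_nbox, card_symBox, norm_one, nsmul_eq_mul, pow_one,
    one_pow, mul_one] at h
  push_cast at h
  have h0 := gramSum_nonneg n θ
  have h2 : (n + 1 : ℝ) * ‖weylSum n θ‖ ^ 2 ≤ (n + 1) * (2 * gramSum n θ) := by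
    nlinarith
  exact le_of_mul_le_mul_left h2 (by positivity)

lemma norm_weylSum_le (n : ℕ) (θ : ℝ) : ‖weylSum n θ‖ ≤ n + 1 := by
  refine (norm_sum_le _ _).trans ?_
  simp [norm_eC]

lemma sum_inv_one_add_le {T : ℝ} (hT : 0 < T) (R : ℕ) :
    ∑ r ∈ Finset.range (R + 1), 1 / (1 + T * r) ≤ 1 + Real.log (1 + T * R) / T := by
  induction R with
  | zero => simp
  | succ R ih =>
    rw [Finset.sum_range_succ]
    have h1 : (0 : ℝ) < 1 + T * R := by positivity
    have h2 : (0 : ℝ) < 1 + T * (R + 1 : ℕ) := by positivity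
    have h := Real.one_sub_inv_le_log_of_pos (div_pos h2 h1)
    rw [Real.log_div h2.ne' h1.ne', inv_div] at h
    have e : 1 - (1 + T * R) / (1 + T * (R + 1 : ℕ)) = T * (1 / (1 + T * (R + 1 : ℕ))) := by
      field_simp
      push_cast
      ring
    rw [e] at h
    have h3 : 1 / (1 + T * (R + 1 : ℕ)) ≤
        (Real.log (1 + T * (R + 1 : ℕ)) - Real.log (1 + T * R)) / T := by
      rw [le_div_iff₀ hT, mul_comm]; exact h
    rw [sub_div] at h3
    linarith

lemma sum_comp_le_two_mul {S : Finset ℤ} {m : ℤ → ℕ} {R : ℕ} (hm : ∀ h ∈ S, m h ≤ R)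
    (hf : ∀ k, (S.filter fun h => m h = k).card ≤ 2) {φ : ℕ → ℝ} (hφ : ∀ k, 0 ≤ φ k) :
    ∑ h ∈ S, φ (m h) ≤ 2 * ∑ k ∈ Finset.range (R + 1), φ k := by
  rw [← Finset.sum_fiberwise_of_maps_to (t := Finset.range (R + 1)) (g := m)
    (fun h hh => Finset.mem_range_succ_iff.2 (hm h hh)), Finset.mul_sum]
  refine Finset.sum_le_sum fun k _ => ?_
  rw [Finset.sum_congr rfl fun h hh => by rw [(Finset.mem_filter.1 hh).2], Finset.sum_const,
    nsmul_eq_mul]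
  exact mul_le_mul_of_nonneg_right (by exact_mod_cast hf k) (hφ k)

/-- Sums of geometric majorants over well-spaced points modulo one. -/
lemma sum_geomMaj_le_of_separated {S : Finset ℤ} {t : ℤ → ℝ} {η D A : ℝ} (hη : 0 < η)
    (hA : 0 < A) (hD : 0 ≤ D) (hsep : ∀ h ∈ S, ∀ h' ∈ S, h ≠ h' → η ≤ distInt (t h - t h'))
    (hSD : ∀ h ∈ S, distInt (t h) ≤ D) :
    ∑ h ∈ S, geomMaj A (t h) ≤ 4 * A + 2 * Real.log (1 + 2 * A * D) / η := by
  set m : ℤ → ℕ := fun h => ⌊distInt (t h) / η⌋₊ with hm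
  set R := ⌊D / η⌋₊ with hR
  have hfl : ∀ h, η * m h ≤ distInt (t h) ∧ distInt (t h) < η * (m h + 1) := fun h => by
    have h0 : 0 ≤ distInt (t h) / η := div_nonneg (distInt_nonneg _) hη.le
    constructor
    · have := Nat.floor_le h0
      rwa [le_div_iff₀ hη, mul_comm] at this
    · have := Nat.lt_floor_add_one (distInt (t h) / η)
      rwa [div_lt_iff₀ hη, mul_comm] at this
  have hclose : ∀ h ∈ S, ∀ h' ∈ S, m h = m h' →
      (0 ≤ t h - round (t h) ↔ 0 ≤ t h' - round (t h')) → h = h' := by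
    intro h hh h' hh' hmm hs
    by_contra hne
    have h1 := hsep h hh h' hh' hne
    have h2 := distInt_le (t h - t h') (round (t h) - round (t h'))
    push_cast at h2
    rw [show t h - t h' - ((round (t h) : ℝ) - round (t h')) =
      (t h - round (t h)) - (t h' - round (t h')) by ring] at h2
    have a1 := hfl h
    have a2 := hfl h'
    rw [← hmm] at a2
    simp only [distInt] at a1 a2
    rcases le_or_gt 0 (t h - round (t h)) with hp | hp
    · have hp' := hs.1 hp
      rw [abs_of_nonneg hp] at a1
      rw [abs_of_nonneg hp'] at a2
      have : |(t h - round (t h)) - (t h' - round (t h'))| < η := by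
        rw [abs_lt]; constructor <;> linarith
      linarith
    · have hp' : t h' - round (t h') < 0 := not_le.1 fun h3 => not_le.2 hp (hs.2 h3)
      rw [abs_of_neg hp] at a1
      rw [abs_of_neg hp'] at a2
      have : |(t h - round (t h)) - (t h' - round (t h'))| < η := by
        rw [abs_lt]; constructor <;> linarith
      linarith
  have hfib : ∀ k, (S.filter fun h => m h = k).card ≤ 2 := by
    intro k
    by_contra! hcon
    obtain ⟨a, ha, b, hb, c, hc, hab, hac, hbc⟩ := Finset.two_lt_card.1 hcon
    rw [Finset.mem_filter] at ha hb hc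
    have h1 := mt (hclose a ha.1 b hb.1 (ha.2.trans hb.2.symm)) hab
    have h2 := mt (hclose a ha.1 c hc.1 (ha.2.trans hc.2.symm)) hac
    have h3 := mt (hclose b hb.1 c hc.1 (hb.2.trans hc.2.symm)) hbc
    tauto
  have hmR : ∀ h ∈ S, m h ≤ R := fun h hh =>
    Nat.floor_mono (div_le_div_of_nonneg_right (hSD h hh) hη.le)
  have hT : 0 < 2 * A * η := by positivity
  have hRD : 2 * A * η * R ≤ 2 * A * D := by
    have := Nat.floor_le (div_nonneg hD hη.le)
    rw [le_div_iff₀ hη] at this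
    rw [mul_assoc, mul_comm η]
    exact mul_le_mul_of_nonneg_left this (by positivity)
  calc ∑ h ∈ S, geomMaj A (t h) ≤ ∑ h ∈ S, 2 * A * (1 / (1 + 2 * A * η * m h)) := by
        refine Finset.sum_le_sum fun h _ => ?_
        rw [geomMaj, mul_one_div, mul_assoc (2 * A)]
        have := (hfl h).1
        gcongr
    _ ≤ 2 * ∑ k ∈ Finset.range (R + 1), 2 * A * (1 / (1 + 2 * A * η * k)) :=
        sum_comp_le_two_mul (φ := fun k : ℕ => 2 * A * (1 / (1 + 2 * A * η * k))) hmR hfib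
          fun k => by positivity
    _ ≤ 2 * (2 * A * (1 + Real.log (1 + 2 * A * D) / (2 * A * η))) := by
        rw [← Finset.mul_sum]
        have h1 := sum_inv_one_add_le hT R
        have h2 : Real.log (1 + 2 * A * η * R) ≤ Real.log (1 + 2 * A * D) :=
          Real.log_le_log (by positivity) (by linarith)
        have h3 := div_le_div_of_nonneg_right h2 hT.le
        gcongr
        linarith
    _ = 4 * A + 2 * Real.log (1 + 2 * A * D) / η := by
        field_simp
        ring

lemma le_distInt_of_abs_le {t : ℝ} (h : |t| ≤ 1 / 2) : |t| ≤ distInt t := by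
  rw [distInt]
  by_cases h0 : round t = 0
  · simp [h0]
  · have h1 : (1 : ℝ) ≤ |(round t : ℝ)| := by exact_mod_cast Int.one_le_abs h0
    have h2 := abs_sub_abs_le_abs_sub (round t : ℝ) t
    rw [abs_sub_comm] at h2
    linarith

/-- The Gram row sum for `θ` close to zero. -/
lemma gramSum_le_of_small {n : ℕ} {θ : ℝ} (hθ : 0 < θ) (hn : 8 * θ * n ≤ 1) :
    gramSum n θ ≤ 4 * (n + 1) + Real.log (1 + 4 * ((n + 1) ^ 2 * θ)) / θ := by
  have habs : ∀ h ∈ Finset.Icc (-n : ℤ) n, |(h : ℝ)| ≤ n := fun h hh => by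
    rw [Finset.mem_Icc] at hh
    rw [abs_le]
    exact ⟨by exact_mod_cast hh.1, by exact_mod_cast hh.2⟩
  refine (sum_geomMaj_le_of_separated (t := fun h => 2 * θ * h) (η := 2 * θ) (D := 2 * θ * n)
    (by positivity) (by positivity) (by positivity) ?_ ?_).trans ?_
  · intro h hh h' hh' hne
    have e : 2 * θ * (h : ℝ) - 2 * θ * h' = 2 * θ * ((h : ℝ) - h') := by ring
    have h1 : |(h : ℝ) - h'| ≤ 2 * n :=
      (abs_sub _ _).trans (by linarith [habs h hh, habs h' hh'])
    have h2 : (1 : ℝ) ≤ |(h : ℝ) - h'| := by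
      exact_mod_cast Int.one_le_abs (sub_ne_zero.2 hne)
    have h3 : |2 * θ * ((h : ℝ) - h')| = 2 * θ * |(h : ℝ) - h'| := by
      rw [abs_mul, abs_of_pos (by positivity : 0 < 2 * θ)]
    rw [e]
    refine le_trans ?_ (le_distInt_of_abs_le ?_)
    · rw [h3]; nlinarith
    · rw [h3]; nlinarith
  · intro h hh
    refine (distInt_le _ 0).trans ?_
    rw [Int.cast_zero, sub_zero, abs_mul, abs_of_pos (by positivity : 0 < 2 * θ)]
    exact mul_le_mul_of_nonneg_left (habs h hh) (by positivity)
  · rw [mul_div_mul_left _ _ two_ne_zero]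
    have : Real.log (1 + 2 * ((n : ℝ) + 1) * (2 * θ * n)) ≤
        Real.log (1 + 4 * (((n : ℝ) + 1) ^ 2 * θ)) := by
      apply Real.log_le_log (by positivity)
      nlinarith [(by positivity : 0 ≤ θ * (n + 1))]
    have := div_le_div_of_nonneg_right this hθ.le
    linarith

lemma le_distInt_of_rational_approx {N θ : ℝ} {a k : ℤ} {q : ℕ} (hN : 0 < N)
    (hq : N < q) (hq8 : q ≤ 8 * N) (hcop : IsCoprime (q : ℤ) a)
    (hθ : |θ - a / q| ≤ 1 / (8 * q * N)) (hk : k ≠ 0) (hkN : 2 * |(k : ℝ)| ≤ N) :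
    1 / (16 * N) ≤ distInt (2 * θ * k) := by
  have hq0 : (0 : ℝ) < q := hN.trans hq
  set m := round (2 * θ * k) with hm
  have hne : 2 * k * a - m * q ≠ 0 := by
    intro h0
    have h1 : (q : ℤ) ∣ 2 * k * a := ⟨m, by linarith⟩
    have h2 : (q : ℤ) ∣ 2 * k := hcop.dvd_of_dvd_mul_right h1
    have h3 := Int.le_of_dvd (by positivity) ((dvd_abs _ _).2 h2)
    have h4 : (q : ℝ) ≤ |2 * (k : ℝ)| := by exact_mod_cast h3
    rw [abs_mul, abs_two] at h4
    linarith
  have h1 : (1 : ℝ) ≤ |2 * (k : ℝ) * a - m * q| := by exact_mod_cast Int.one_le_abs hne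
  have h2 : 1 / (q : ℝ) ≤ |2 * k * (a / q : ℝ) - m| := by
    rw [div_le_iff₀ hq0]
    calc (1 : ℝ) ≤ |2 * (k : ℝ) * a - m * q| := h1
      _ = |2 * k * (a / q : ℝ) - m| * q := by
        rw [← abs_of_pos hq0, ← abs_mul, abs_of_pos hq0]
        congr 1
        field_simp
  have h3 : |2 * (k : ℝ) * (θ - a / q)| ≤ 1 / (8 * q) := by
    rw [abs_mul, abs_mul, abs_two]
    calc 2 * |(k : ℝ)| * |θ - a / q| ≤ N * (1 / (8 * q * N)) :=
          mul_le_mul hkN hθ (abs_nonneg _) hN.le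
      _ = 1 / (8 * q) := by field_simp
  have h4 := abs_sub_abs_le_abs_sub (2 * (k : ℝ) * (a / q) - m) (-(2 * (k : ℝ) * (θ - a / q)))
  rw [abs_neg, show 2 * (k : ℝ) * (a / q) - m - -(2 * (k : ℝ) * (θ - a / q)) =
    2 * θ * k - m by ring] at h4
  rw [distInt, ← hm]
  have h5 : 1 / (q : ℝ) - 1 / (8 * q) = 7 / (8 * q) := by field_simp; norm_num
  have h6 : 1 / (16 * N) ≤ 7 / (8 * (q : ℝ)) := by
    rw [div_le_div_iff₀ (by positivity) (by positivity)]
    linarith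
  linarith

/-- The Gram row sum on the genuine minor arcs. -/
lemma gramSum_le_of_rational_approx {n : ℕ} {N θ : ℝ} {a : ℤ} {q : ℕ} (hN : 0 < N) (hn : n ≤ N)
    (hq : N < q) (hq8 : q ≤ 8 * N) (hcop : IsCoprime (q : ℤ) a)
    (hθ : |θ - a / q| ≤ 1 / (8 * q * N)) :
    gramSum n θ ≤ 16 * (n + 1) + 128 * N * Real.log (n + 2) := by
  set L : ℤ := (n / 2 : ℕ) + 1 with hL
  have hL0 : 0 < L := by positivity
  have hLn : (n : ℤ) < 2 * L := by omega
  have hmaps : ∀ h ∈ Finset.Icc (-n : ℤ) n, h / L ∈ Finset.Icc (-2 : ℤ) 1 := by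
    intro h hh
    rw [Finset.mem_Icc] at hh ⊢
    constructor
    · rw [Int.le_ediv_iff_mul_le hL0]; linarith
    · have : h / L < 2 := by rw [Int.ediv_lt_iff_lt_mul hL0]; linarith
      omega
  rw [gramSum, ← Finset.sum_fiberwise_of_maps_to hmaps]
  have hb : ∀ b ∈ Finset.Icc (-2 : ℤ) 1,
      ∑ h ∈ (Finset.Icc (-n : ℤ) n).filter (fun h => h / L = b), geomMaj (n + 1) (2 * θ * h) ≤
        4 * (n + 1) + 2 * Real.log (1 + 2 * (n + 1) * (1 / 2)) / (1 / (16 * N)) := by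
    intro b _
    refine sum_geomMaj_le_of_separated (t := fun h => 2 * θ * h) (by positivity) (by positivity)
      (by positivity) ?_ fun h _ => distInt_le_half _
    intro h hh h' hh' hne
    rw [Finset.mem_filter] at hh hh'
    rw [← mul_sub, ← Int.cast_sub]
    refine le_distInt_of_rational_approx hN hq hq8 hcop hθ (sub_ne_zero.2 hne) ?_
    have e1 := Int.mul_ediv_add_emod h L
    have e2 := Int.mul_ediv_add_emod h' L
    have f1 := Int.emod_nonneg h hL0.ne'
    have f2 := Int.emod_nonneg h' hL0.ne'
    have f3 := Int.emod_lt_of_pos h hL0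
    have f4 := Int.emod_lt_of_pos h' hL0
    rw [hh.2] at e1
    rw [hh'.2] at e2
    have : 2 * |h - h'| ≤ n := by
      have : |h - h'| ≤ L - 1 := by rw [abs_le]; constructor <;> linarith
      omega
    have : 2 * |((h - h' : ℤ) : ℝ)| ≤ n := by exact_mod_cast this
    linarith
  refine (Finset.sum_le_sum hb).trans (le_of_eq ?_)
  rw [Finset.sum_const, Int.card_Icc, nsmul_eq_mul,
    show (1 : ℝ) + 2 * (n + 1) * (1 / 2) = n + 2 by ring,
    show ((1 + 1 - -2 : ℤ).toNat : ℝ) = 4 by norm_num [show Int.toNat 4 = 4 from rfl]]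
  field_simp
  ring

lemma rpow_sum_le_sum_rpow {ι : Type*} (s : Finset ι) (f : ι → ℝ≥0∞) {p : ℝ} (hp : 0 < p)
    (hp1 : p ≤ 1) : (∑ i ∈ s, f i) ^ p ≤ ∑ i ∈ s, f i ^ p := by
  classical
  induction s using Finset.induction_on with
  | empty => simp [hp]
  | insert a s ha ih =>
    rw [Finset.sum_insert ha, Finset.sum_insert ha]
    exact (ENNReal.rpow_add_le_add_rpow _ _ hp.le hp1).trans (add_le_add_right ih _)

lemma sum_rpow_weylOp_le (d n : ℕ) (θ : ℝ) (f : V d → ℂ) {p W : ℝ} (hp : 1 ≤ p) (hp2 : p ≤ 2)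
    (hW : gramSum n θ ≤ W) :
    ∑ r ∈ nbox d n, ‖weylOp d n θ f r‖ₑ ^ p ≤
      ((n + 1 : ℝ≥0∞) ^ d) ^ (1 - p / 2) * (ENNReal.ofReal W ^ d) ^ (p / 2) *
        ∑ y ∈ symBox d n, ‖f y‖ₑ ^ p := by
  have hp0 : 0 < p := by linarith
  have hp' : 0 < p / 2 := by positivity
  have hW0 : 0 ≤ W := (gramSum_nonneg n θ).trans hW
  have key : ∑ r ∈ nbox d n, ‖weylOp d n θ f r‖ₑ ^ (2 : ℝ) ≤
      ENNReal.ofReal W ^ d * ∑ y ∈ symBox d n, ‖f y‖ₑ ^ (2 : ℝ) := by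
    have h := (sum_norm_sq_weylOp_le d n θ f).trans (mul_le_mul_of_nonneg_right
      (pow_le_pow_left₀ (gramSum_nonneg n θ) hW d) (Finset.sum_nonneg fun y _ => sq_nonneg ‖f y‖))
    have h2 := ENNReal.ofReal_le_ofReal h
    rw [ENNReal.ofReal_mul (by positivity), ENNReal.ofReal_pow hW0,
      ENNReal.ofReal_sum_of_nonneg fun _ _ => sq_nonneg _,
      ENNReal.ofReal_sum_of_nonneg fun _ _ => sq_nonneg _] at h2
    simpa only [ENNReal.ofReal_pow (norm_nonneg _), ofReal_norm, ENNReal.rpow_ofNat]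
      using h2
  have hol := ENNReal.rpow_sum_le_const_mul_sum_rpow (nbox d n)
    (fun r => ‖weylOp d n θ f r‖ₑ ^ p) (p := 2 / p) (by rw [le_div_iff₀ hp0]; linarith)
  have hol2 := ENNReal.rpow_le_rpow hol hp'.le
  rw [← ENNReal.rpow_mul, show 2 / p * (p / 2) = 1 by field_simp, ENNReal.rpow_one,
    ENNReal.mul_rpow_of_nonneg _ _ hp'.le, ← ENNReal.rpow_mul,
    show (2 / p - 1) * (p / 2) = 1 - p / 2 by field_simp, card_nbox] at hol2
  refine hol2.trans ?_
  push_cast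
  rw [mul_assoc]
  refine mul_le_mul_right ?_ _
  simp only [← ENNReal.rpow_mul, show p * (2 / p) = 2 by field_simp]
  refine (ENNReal.rpow_le_rpow key hp'.le).trans ?_
  rw [ENNReal.mul_rpow_of_nonneg _ _ hp'.le]
  refine mul_le_mul_right ((rpow_sum_le_sum_rpow _ _ hp' (by linarith)).trans (le_of_eq ?_)) _
  simp only [← ENNReal.rpow_mul, show 2 * (p / 2) = p by ring]

lemma tsum_sum_translate {d : ℕ} (S : Finset (V d)) (F : V d → ℝ≥0∞) :
    ∑' z, ∑ r ∈ S, F (z + r) = S.card * ∑' x, F x := by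
  rw [Summable.tsum_finsetSum fun _ _ => ENNReal.summable,
    Finset.sum_congr rfl fun r _ => show ∑' z, F (z + r) = ∑' x, F x from
      (Equiv.addRight r).tsum_eq F, Finset.sum_const, nsmul_eq_mul]

lemma tsum_rpow_weylOp_le (d n : ℕ) (θ : ℝ) (f : V d → ℂ) {p W : ℝ} (hp : 1 ≤ p) (hp2 : p ≤ 2)
    (hW : gramSum n θ ≤ W) :
    ∑' x, ‖weylOp d n θ f x‖ₑ ^ p ≤
      2 ^ d * (((n + 1 : ℝ≥0∞) ^ d) ^ (1 - p / 2) * (ENNReal.ofReal W ^ d) ^ (p / 2)) *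
        ∑' y, ‖f y‖ₑ ^ p := by
  have h1 : ∑' z, ∑ r ∈ nbox d n, ‖weylOp d n θ f (z + r)‖ₑ ^ p ≤
      ∑' z, (((n + 1 : ℝ≥0∞) ^ d) ^ (1 - p / 2) * (ENNReal.ofReal W ^ d) ^ (p / 2) *
        ∑ y ∈ symBox d n, ‖f (z + y)‖ₑ ^ p) := by
    refine ENNReal.tsum_le_tsum fun z => ?_
    have := sum_rpow_weylOp_le d n θ (fun y => f (z + y)) hp hp2 hW
    simpa only [weylOp, add_sub_assoc] using this
  rw [tsum_sum_translate (nbox d n) (fun x => ‖weylOp d n θ f x‖ₑ ^ p), ENNReal.tsum_mul_left,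
    tsum_sum_translate (symBox d n) (fun x => ‖f x‖ₑ ^ p), card_nbox, card_symBox] at h1
  push_cast at h1
  have hA0 : (n + 1 : ℝ≥0∞) ^ d ≠ 0 := by positivity
  have hA : (n + 1 : ℝ≥0∞) ^ d ≠ ⊤ := by finiteness
  rw [← ENNReal.mul_le_mul_iff_right hA0 hA]
  refine h1.trans ?_
  have h2 : (2 * n + 1 : ℝ≥0∞) ^ d ≤ 2 ^ d * (n + 1) ^ d := by
    rw [← mul_pow]
    gcongr
    rw [mul_add, mul_one]
    gcongr
    exact one_le_two
  calc _ ≤ ((n + 1 : ℝ≥0∞) ^ d) ^ (1 - p / 2) * (ENNReal.ofReal W ^ d) ^ (p / 2) *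
        (2 ^ d * (n + 1) ^ d * ∑' y, ‖f y‖ₑ ^ p) := by gcongr
    _ = _ := by ring

lemma one_add_log_le {y : ℝ} (hy : 1 ≤ y) : 1 + Real.log (1 + 4 * y) ≤ 9 * y ^ (1 / 4 : ℝ) := by
  have hy0 : 0 ≤ y := by linarith
  have h1 : Real.log (1 + 4 * y) ≤ Real.log (16 * y) :=
    Real.log_le_log (by positivity) (by linarith)
  have h2 := Real.log_le_rpow_div (x := 16 * y) (by positivity) (show (0 : ℝ) < 1 / 4 by norm_num)
  have h3 : (16 * y) ^ (1 / 4 : ℝ) = 2 * y ^ (1 / 4 : ℝ) := by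
    rw [Real.mul_rpow (by norm_num) hy0, show (16 : ℝ) = 2 ^ (4 : ℝ) by norm_num,
      ← Real.rpow_mul (by norm_num)]
    norm_num
  have h4 : 1 ≤ y ^ (1 / 4 : ℝ) := Real.one_le_rpow hy (by norm_num)
  rw [h3] at h2
  linarith

lemma norm_weylSum_pow_three_le {n : ℕ} {N θ : ℝ} (hn1 : 1 ≤ n) (hn : n ≤ N)
    (hθN : 8 * θ * N ≤ 1) (hy : 1 ≤ ((n : ℝ) + 1) ^ 2 * θ) :
    ‖weylSum n θ‖ ^ 3 ≤ 324 * (n + 1) ^ 3 * (((n : ℝ) + 1) ^ 2 * θ) ^ (-(9 / 8) : ℝ) := by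
  have hn1' : (1 : ℝ) ≤ n := by exact_mod_cast hn1
  set A : ℝ := n + 1 with hA
  set y := A ^ 2 * θ with hydef
  have hA0 : 0 < A := by positivity
  have hy0 : 0 < y := by linarith
  have hθ : 0 < θ := by
    by_contra h
    have : A ^ 2 * θ ≤ 0 := mul_nonpos_of_nonneg_of_nonpos (by positivity) (not_lt.1 h)
    linarith
  have h8 : 8 * θ * n ≤ 1 := by nlinarith
  have h4 : 4 * θ * A ≤ 1 := by nlinarith
  have hG := gramSum_le_of_small hθ h8
  rw [← hA, ← hydef] at hG
  have hθy : θ = y / A ^ 2 := by rw [hydef]; field_simp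
  have h4A : 4 * A ≤ 1 / θ := by rw [le_div_iff₀ hθ]; linarith
  have hG2 : gramSum n θ ≤ (1 + Real.log (1 + 4 * y)) * A ^ 2 / y := by
    have : (1 + Real.log (1 + 4 * y)) * A ^ 2 / y = 1 / θ + Real.log (1 + 4 * y) / θ := by
      rw [hθy]; field_simp
    linarith
  have hs2 : ‖weylSum n θ‖ ^ 2 ≤ 18 * A ^ 2 * y ^ (-(3 / 4) : ℝ) := by
    calc ‖weylSum n θ‖ ^ 2 ≤ 2 * gramSum n θ := norm_weylSum_sq_le n θ
      _ ≤ 2 * (9 * y ^ (1 / 4 : ℝ) * A ^ 2 / y) := by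
        have := one_add_log_le hy
        refine mul_le_mul_of_nonneg_left (hG2.trans ?_) zero_le_two
        gcongr
      _ = 18 * A ^ 2 * y ^ (-(3 / 4) : ℝ) := by
        rw [show (-(3 / 4) : ℝ) = 1 / 4 - 1 by norm_num, Real.rpow_sub_one hy0.ne']
        ring
  have h6 : (‖weylSum n θ‖ ^ 3) ^ 2 ≤ (324 * A ^ 3 * y ^ (-(9 / 8) : ℝ)) ^ 2 := by
    calc (‖weylSum n θ‖ ^ 3) ^ 2 = (‖weylSum n θ‖ ^ 2) ^ 3 := by ring
      _ ≤ (18 * A ^ 2 * y ^ (-(3 / 4) : ℝ)) ^ 3 := pow_le_pow_left₀ (by positivity) hs2 3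
      _ = 5832 * A ^ 6 * y ^ (-(9 / 4) : ℝ) := by
        rw [mul_pow, mul_pow, ← Real.rpow_natCast (y ^ _), ← Real.rpow_mul hy0.le,
          show (-(3 / 4) : ℝ) * (3 : ℕ) = -(9 / 4) by norm_num]
        ring
      _ ≤ 104976 * A ^ 6 * y ^ (-(9 / 4) : ℝ) := by gcongr; norm_num
      _ = (324 * A ^ 3 * y ^ (-(9 / 8) : ℝ)) ^ 2 := by
        rw [mul_pow, mul_pow, ← Real.rpow_natCast (y ^ _), ← Real.rpow_mul hy0.le,
          show (-(9 / 8) : ℝ) * (2 : ℕ) = -(9 / 4) by norm_num]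
        ring
  exact le_of_sq_le_sq h6 (by positivity)

lemma lintegral_Ioi_rpow {c : ℝ} (hc : 0 < c) :
    ∫⁻ t in Set.Ioi c, ENNReal.ofReal (t ^ (-(9 / 8) : ℝ)) =
      ENNReal.ofReal (8 * c ^ (-(1 / 8) : ℝ)) := by
  rw [← ofReal_integral_eq_lintegral_ofReal
    (integrableOn_Ioi_rpow_of_lt (by norm_num : (-(9 / 8) : ℝ) < -1) hc),
    integral_Ioi_rpow_of_lt (by norm_num) hc]
  · congr 1
    rw [show (-(9 / 8) : ℝ) + 1 = -(1 / 8) by norm_num]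
    ring
  · filter_upwards [ae_restrict_mem measurableSet_Ioi] with t ht
    exact Real.rpow_nonneg (hc.trans ht).le _

/-- The contribution of a neighbourhood of the origin to the `L^d` norm of the Weyl sum. -/
lemma lintegral_weylSum_pow_le {d n : ℕ} {N : ℝ} (hd : 3 ≤ d) (hn1 : 1 ≤ n) (hn : n ≤ N) :
    ∫⁻ θ in Set.Icc 0 (1 / (8 * N)), ‖weylSum n θ‖ₑ ^ d ≤
      ENNReal.ofReal (2593 * ((n : ℝ) + 1) ^ (d - 2)) := by
  obtain ⟨k, rfl⟩ := Nat.exists_eq_add_of_le hd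
  have hn1' : (1 : ℝ) ≤ n := by exact_mod_cast hn1
  have hN : 0 < N := by linarith
  set A : ℝ := n + 1 with hA
  have hA0 : 0 < A := by positivity
  set c : ℝ := (A ^ 2)⁻¹ with hc
  have hc0 : 0 < c := by positivity
  have hsub : Set.Ioc 0 (1 / (8 * N)) ⊆ Set.Ioc 0 c ∪ (Set.Ioc 0 (1 / (8 * N)) ∩ Set.Ioi c) := by
    intro θ hθ
    rcases le_or_gt θ c with h | h
    · exact Or.inl ⟨hθ.1, h⟩
    · exact Or.inr ⟨hθ, h⟩
  have hen : ∀ θ, ‖weylSum n θ‖ₑ ^ (3 + k) = ENNReal.ofReal (‖weylSum n θ‖ ^ (3 + k)) := fun θ => by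
    rw [ENNReal.ofReal_pow (norm_nonneg _), ofReal_norm]
  have h1 : ∫⁻ θ in Set.Ioc 0 c, ‖weylSum n θ‖ₑ ^ (3 + k) ≤ ENNReal.ofReal (A ^ (k + 1)) := by
    calc ∫⁻ θ in Set.Ioc 0 c, ‖weylSum n θ‖ₑ ^ (3 + k)
        ≤ ∫⁻ _ in Set.Ioc 0 c, ENNReal.ofReal (A ^ (3 + k)) := by
          refine lintegral_mono fun θ => ?_
          rw [hen]
          exact ENNReal.ofReal_le_ofReal
            (pow_le_pow_left₀ (norm_nonneg _) (norm_weylSum_le n θ) _)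
      _ = ENNReal.ofReal (A ^ (k + 1)) := by
          rw [setLIntegral_const, Real.volume_Ioc, sub_zero, ← ENNReal.ofReal_mul (by positivity)]
          congr 1
          rw [hc]
          field_simp
          ring
  have h2 : ∫⁻ θ in Set.Ioc 0 (1 / (8 * N)) ∩ Set.Ioi c, ‖weylSum n θ‖ₑ ^ (3 + k) ≤
      ENNReal.ofReal (2592 * A ^ (k + 1)) := by
    have e : A ^ k * (324 * A ^ 3 * (A ^ 2) ^ (-(9 / 8) : ℝ)) * (8 * c ^ (-(1 / 8) : ℝ)) =
        2592 * A ^ (k + 1) := by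
      have : (A ^ 2) ^ (-(9 / 8) : ℝ) * c ^ (-(1 / 8) : ℝ) = (A ^ 2)⁻¹ := by
        rw [hc, Real.inv_rpow (by positivity), ← Real.rpow_neg (by positivity),
          ← Real.rpow_add (by positivity), ← Real.rpow_neg_one]
        norm_num
      calc _ = 2592 * A ^ (k + 3) * ((A ^ 2) ^ (-(9 / 8) : ℝ) * c ^ (-(1 / 8) : ℝ)) := by ring
        _ = _ := by rw [this]; field_simp; ring
    rw [← e, ENNReal.ofReal_mul (by positivity), ← lintegral_Ioi_rpow hc0,
      ← lintegral_const_mul' _ _ ENNReal.ofReal_ne_top]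
    refine (setLIntegral_mono' (measurableSet_Ioc.inter measurableSet_Ioi) fun θ hθ => ?_).trans
      (lintegral_mono_set Set.inter_subset_right)
    rw [hen, ← ENNReal.ofReal_mul (by positivity)]
    refine ENNReal.ofReal_le_ofReal ?_
    have hθ0 : 0 < θ := hθ.1.1
    have hθN : 8 * θ * N ≤ 1 := by
      have := hθ.1.2
      rw [le_div_iff₀ (by positivity)] at this
      linarith
    have hy : 1 ≤ A ^ 2 * θ := by
      have : c < θ := hθ.2
      rw [hc, inv_lt_iff_one_lt_mul₀ (by positivity)] at this
      linarith
    have h3 := norm_weylSum_pow_three_le hn1 hn hθN hy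
    rw [← hA, Real.mul_rpow (by positivity) hθ0.le] at h3
    calc ‖weylSum n θ‖ ^ (3 + k) = ‖weylSum n θ‖ ^ k * ‖weylSum n θ‖ ^ 3 := by ring
      _ ≤ A ^ k * (324 * A ^ 3 * ((A ^ 2) ^ (-(9 / 8) : ℝ) * θ ^ (-(9 / 8) : ℝ))) :=
        mul_le_mul (pow_le_pow_left₀ (norm_nonneg _) (norm_weylSum_le n θ) _) h3
          (by positivity) (by positivity)
      _ = _ := by ring
  rw [setLIntegral_congr Ioc_ae_eq_Icc.symm]
  refine (lintegral_mono_set hsub).trans ((lintegral_union_le _ _ _).trans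
    ((add_le_add h1 h2).trans (le_of_eq ?_)))
  rw [← ENNReal.ofReal_add (by positivity) (by positivity), show 3 + k - 2 = k + 1 by omega]
  congr 1
  ring

lemma measurableSet_minorArcs (N : ℝ) : MeasurableSet (minorArcs N) := by
  refine measurableSet_Icc.diff ?_
  refine MeasurableSet.iUnion fun q => MeasurableSet.iUnion fun _ => MeasurableSet.iUnion fun a =>
    MeasurableSet.iUnion fun _ => IsClosed.measurableSet ?_
  exact isClosed_Icc.inter (isClosed_le
    (by fun_prop : Continuous fun θ : ℝ => |θ - (a : ℝ) / q|) continuous_const)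

lemma exists_rational_approx_of_mem_minorArcs {N θ : ℝ} (hN : 1 ≤ N) (hθ : θ ∈ minorArcs N)
    (hθ' : θ ∉ Set.Icc 0 (1 / (8 * N))) :
    ∃ (a : ℤ) (q : ℕ), N < q ∧ q ≤ 8 * N ∧ IsCoprime (q : ℤ) a ∧
      |θ - a / q| ≤ 1 / (8 * q * N) := by
  have hN0 : 0 < N := by linarith
  obtain ⟨⟨h0, h1⟩, hmaj⟩ := hθ
  have hθN : 1 / (8 * N) < θ := by
    by_contra h
    exact hθ' ⟨h0, not_lt.1 h⟩
  have hfl : 0 < ⌊8 * N⌋₊ := Nat.floor_pos.2 (by linarith)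
  obtain ⟨r, hr, hrd⟩ := Real.exists_rat_abs_sub_le_and_den_le θ hfl
  have hden : (0 : ℝ) < r.den := by exact_mod_cast r.den_pos
  have hden1 : (1 : ℝ) ≤ r.den := by exact_mod_cast r.den_pos
  have hcast : (r : ℝ) = (r.num : ℝ) / r.den := Rat.cast_def r
  have happ : |θ - r.num / r.den| ≤ 1 / (8 * r.den * N) := by
    rw [← hcast]
    refine hr.trans (one_div_le_one_div_of_le (by positivity) ?_)
    have := Nat.lt_floor_add_one (8 * N)
    nlinarith
  have hcop : IsCoprime (r.den : ℤ) r.num := by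
    rw [Int.isCoprime_iff_nat_coprime, Int.natAbs_natCast]
    exact r.reduced.symm
  refine ⟨r.num, r.den, ?_, (by exact_mod_cast hrd : (r.den : ℝ) ≤ ⌊8 * N⌋₊).trans
    (Nat.floor_le (by positivity)), hcop, happ⟩
  by_contra! hle
  have hab := abs_le.1 happ
  have hsmall : 1 / (8 * r.den * N) ≤ 1 / (8 * N) :=
    one_div_le_one_div_of_le (by positivity) (by nlinarith)
  have hpos : 0 < r.num := by
    have : (0 : ℝ) < r.num / r.den := by linarith
    rw [div_pos_iff_of_pos_right hden] at this
    exact_mod_cast this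
  have hnum : r.num ≤ r.den := by
    have h2 : (r.num : ℝ) / r.den ≤ 1 + 1 / (8 * r.den * N) := by linarith
    rw [div_le_iff₀ hden] at h2
    have h3 : (1 + 1 / (8 * r.den * N)) * r.den = r.den + 1 / (8 * N) := by field_simp
    have h4 : 1 / (8 * N) < 1 := by rw [div_lt_one (by positivity)]; linarith
    have : (r.num : ℝ) < (r.den + 1 : ℤ) := by push_cast; linarith
    exact Int.lt_add_one_iff.1 (by exact_mod_cast this)
  have hnat : ((r.num.natAbs : ℕ) : ℤ) = r.num := Int.natAbs_of_nonneg hpos.le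
  have hnatR : ((r.num.natAbs : ℕ) : ℝ) = r.num := by
    rw [← Int.cast_natCast, hnat]
  apply hmaj
  simp only [majorArcs, Set.mem_iUnion]
  refine ⟨r.den, ⟨r.den_pos, hle⟩, r.num.natAbs, ⟨by omega, by omega, r.reduced⟩, ⟨h0, h1⟩, ?_⟩
  rwa [hnatR]

/-- The Gram row sum away from the origin on the minor arcs. -/
lemma gramSum_le_of_mem_minorArcs {n : ℕ} {N θ : ℝ} (hN : 1 ≤ N) (hn : n ≤ N) (hn' : N < n + 1)
    (hθ : θ ∈ minorArcs N) (hθ' : θ ∉ Set.Icc 0 (1 / (8 * N))) :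
    gramSum n θ ≤ 2576 * ((n : ℝ) + 1) ^ (11 / 10 : ℝ) := by
  obtain ⟨a, q, hq, hq8, hcop, happ⟩ := exists_rational_approx_of_mem_minorArcs hN hθ hθ'
  have h := gramSum_le_of_rational_approx (by linarith) hn hq hq8 hcop happ
  have hA : (1 : ℝ) ≤ (n : ℝ) + 1 := by linarith
  have hlog : Real.log ((n : ℝ) + 2) ≤ 20 * ((n : ℝ) + 1) ^ (1 / 10 : ℝ) := by
    have h1 : Real.log ((n : ℝ) + 2) ≤ Real.log (2 * ((n : ℝ) + 1)) :=
      Real.log_le_log (by positivity) (by linarith)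
    have h2 := Real.log_le_rpow_div (x := 2 * ((n : ℝ) + 1)) (by positivity)
      (show (0 : ℝ) < 1 / 10 by norm_num)
    rw [Real.mul_rpow (by norm_num) (by positivity)] at h2
    have h3 : (2 : ℝ) ^ (1 / 10 : ℝ) ≤ 2 := by
      calc (2 : ℝ) ^ (1 / 10 : ℝ) ≤ 2 ^ (1 : ℝ) :=
            Real.rpow_le_rpow_of_exponent_le one_le_two (by norm_num)
        _ = 2 := Real.rpow_one 2
    have h4 : 0 ≤ ((n : ℝ) + 1) ^ (1 / 10 : ℝ) := by positivity
    have h5 := mul_le_mul_of_nonneg_right h3 h4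
    linarith
  have hpow : ((n : ℝ) + 1) ^ (11 / 10 : ℝ) = (n + 1) * ((n : ℝ) + 1) ^ (1 / 10 : ℝ) := by
    rw [show (11 / 10 : ℝ) = 1 + 1 / 10 by norm_num, Real.rpow_add (by positivity), Real.rpow_one]
  have h1 : 1 ≤ ((n : ℝ) + 1) ^ (1 / 10 : ℝ) := Real.one_le_rpow hA (by norm_num)
  have h2 : 128 * N * Real.log ((n : ℝ) + 2) ≤
      128 * (n + 1) * (20 * ((n : ℝ) + 1) ^ (1 / 10 : ℝ)) := by
    have : 0 ≤ Real.log ((n : ℝ) + 2) := Real.log_nonneg (by linarith)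
    gcongr
  rw [hpow]
  nlinarith

lemma box_eq_nbox (d : ℕ) {N : ℝ} (hN : 0 ≤ N) : box d N = nbox d ⌊N⌋₊ := by
  rw [box, nbox, Int.natCast_floor_eq_floor hN]

lemma weylSum_pow (d n : ℕ) (θ : ℝ) :
    weylSum n θ ^ d = ∑ v ∈ nbox d n, eC (θ * ∑ i, (v i : ℝ) ^ 2) := by
  have h := Finset.prod_univ_sum (ι := Fin d) (fun _ => Finset.Icc (0 : ℤ) n)
    (fun _ v => eC (θ * (v : ℝ) ^ 2))
  rw [Finset.prod_const, Finset.card_univ, Fintype.card_fin] at h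
  rw [weylSum, h, nbox]
  refine Finset.sum_congr rfl fun v _ => ?_
  rw [Finset.mul_sum, eC_sum]

lemma sum_sum_eC_eq {d n : ℕ} (lam : ℕ) (θ : ℝ) (f : V d → ℂ) (x : V d) :
    ∑ u ∈ nbox d n, ∑ v ∈ nbox d n,
      eC (θ * (((∑ i, u i ^ 2) + (∑ i, v i ^ 2) - (lam : ℤ) : ℤ) : ℝ)) * f (x - u) =
    eC (-(θ * lam)) * (weylSum n θ ^ d * weylOp d n θ f x) := by
  rw [weylSum_pow, weylOp, Finset.sum_mul_sum, Finset.sum_comm, Finset.mul_sum]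
  refine Finset.sum_congr rfl fun v _ => ?_
  rw [Finset.mul_sum]
  refine Finset.sum_congr rfl fun u _ => ?_
  rw [← mul_assoc, ← mul_assoc, mul_assoc (eC _), ← eC_add, ← eC_add]
  push_cast
  congr 2
  ring

lemma continuous_weylOp (d n : ℕ) (f : V d → ℂ) (x : V d) :
    Continuous fun θ => weylOp d n θ f x := by
  refine continuous_finsetSum _ fun u _ => Continuous.mul (continuous_eC.comp ?_) continuous_const
  fun_prop

lemma enorm_eC (t : ℝ) : ‖eC t‖ₑ = 1 := by
  rw [← ofReal_norm, norm_eC, ENNReal.ofReal_one]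

lemma enorm_Eminor_le (d lam : ℕ) {N : ℝ} (hN : 0 ≤ N) (f : V d → ℂ) (x : V d) :
    ‖Eminor d lam N f x‖ₑ ≤ (Ncount d lam : ℝ≥0∞)⁻¹ * ∫⁻ θ in minorArcs N,
      ‖weylSum ⌊N⌋₊ θ‖ₑ ^ d * ‖weylOp d ⌊N⌋₊ θ f x‖ₑ := by
  rw [Eminor, enorm_mul]
  refine mul_le_mul' ?_ ?_
  · rcases eq_or_ne (Ncount d lam : ℂ) 0 with h | h
    · simp [h]
    · rw [enorm_inv h, ← ofReal_norm, Complex.norm_natCast, ENNReal.ofReal_natCast]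
  · refine (enorm_integral_le_lintegral_enorm _).trans (le_of_eq ?_)
    refine lintegral_congr fun θ => ?_
    rw [box_eq_nbox d hN, sum_sum_eC_eq, enorm_mul, enorm_mul, enorm_pow, enorm_eC, one_mul]

lemma enorm_weylOp_le (d n : ℕ) (θ : ℝ) (f : V d → ℂ) (x : V d) :
    ‖weylOp d n θ f x‖ₑ ≤ ∑ u ∈ nbox d n, ‖f (x - u)‖ₑ := by
  refine (enorm_sum_le _ _).trans (Finset.sum_le_sum fun u _ => ?_)
  rw [enorm_mul, enorm_eC, one_mul]

lemma sum_nbox_le_maxHL {d n : ℕ} (hn : 1 ≤ n) (g : V d → ℝ≥0∞) (x : V d) :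
    ∑ u ∈ nbox d n, g (x - u) ≤ (2 * (n + 1)) ^ d * maxHL g x := by
  set k := Nat.log 2 n + 1 with hk
  have h1 : n ≤ 2 ^ k := (Nat.lt_pow_succ_log_self one_lt_two n).le
  have h2 : 2 ^ k ≤ 2 * (n + 1) := by
    have := Nat.pow_log_le_self 2 (show n ≠ 0 by omega)
    rw [hk, pow_succ]
    omega
  have h3 : ∑ u ∈ nbox d n, g (x - u) ≤ ∑ y ∈ cube x (2 ^ k), g y := by
    have e : ∑ u ∈ nbox d n, g (x - u) = ∑ y ∈ (nbox d n).image (fun u => x - u), g y := by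
      rw [Finset.sum_image fun a _ b _ h => sub_right_injective h]
    rw [e]
    refine Finset.sum_le_sum_of_subset fun y hy => ?_
    obtain ⟨u, hu, rfl⟩ := Finset.mem_image.1 hy
    rw [mem_cube]
    intro i
    have hui := Fintype.mem_piFinset.1 hu i
    rw [Finset.mem_Icc] at hui
    rw [Pi.sub_apply, sub_sub_cancel_left, abs_neg, abs_of_nonneg hui.1]
    exact hui.2.trans (by exact_mod_cast h1)
  have h4 := le_iSup (fun k : ℕ => (∑ y ∈ cube x (2 ^ k), g y) / ((2 ^ k : ℕ) : ℝ≥0∞) ^ d) k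
  have h5 : ((2 ^ k : ℕ) : ℝ≥0∞) ^ d ≠ 0 := by simp
  rw [ENNReal.div_le_iff h5 (by finiteness)] at h4
  calc _ ≤ _ := h3
    _ ≤ maxHL g x * ((2 ^ k : ℕ) : ℝ≥0∞) ^ d := h4
    _ ≤ maxHL g x * (2 * (n + 1)) ^ d := by
      gcongr
      exact_mod_cast h2
    _ = _ := mul_comm _ _

/-- The minor arcs with the neighbourhood of the origin removed. -/
def tailArcs (N : ℝ) : Set ℝ := minorArcs N \ Set.Icc 0 (1 / (8 * N))

lemma enorm_Eminor_le_add {d : ℕ} (hd : 3 ≤ d) (lam : ℕ) {N : ℝ} (hN : 1 ≤ N) (f : V d → ℂ)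
    (x : V d) :
    ‖Eminor d lam N f x‖ₑ ≤ (Ncount d lam : ℝ≥0∞)⁻¹ *
      (ENNReal.ofReal (2593 * ((⌊N⌋₊ : ℝ) + 1) ^ (d - 2)) * ((2 * (⌊N⌋₊ + 1)) ^ d *
        maxHL (fun y => ‖f y‖ₑ) x) +
      ENNReal.ofReal (5152 * ((⌊N⌋₊ : ℝ) + 1) ^ (11 / 10 : ℝ)) ^ (d / 2 : ℝ) *
        ∫⁻ θ in tailArcs N, ‖weylOp d ⌊N⌋₊ θ f x‖ₑ) := by
  have hN0 : 0 ≤ N := by linarith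
  have hn : (⌊N⌋₊ : ℝ) ≤ N := Nat.floor_le hN0
  have hn' : N < ⌊N⌋₊ + 1 := Nat.lt_floor_add_one N
  have hn1 : 1 ≤ ⌊N⌋₊ := Nat.floor_pos.2 hN
  refine (enorm_Eminor_le d lam hN0 f x).trans (mul_le_mul_right ?_ _)
  have hsub : minorArcs N ⊆ Set.Icc 0 (1 / (8 * N)) ∪ tailArcs N := fun θ hθ => by
    by_cases h : θ ∈ Set.Icc 0 (1 / (8 * N))
    · exact Or.inl h
    · exact Or.inr ⟨hθ, h⟩
  refine (lintegral_mono_set hsub).trans ((lintegral_union_le _ _ _).trans (add_le_add ?_ ?_))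
  · calc _ ≤ ∫⁻ θ in Set.Icc 0 (1 / (8 * N)), ‖weylSum ⌊N⌋₊ θ‖ₑ ^ d *
          ∑ u ∈ nbox d ⌊N⌋₊, ‖f (x - u)‖ₑ :=
        lintegral_mono fun θ => mul_le_mul_right (enorm_weylOp_le d _ θ f x) _
      _ = (∫⁻ θ in Set.Icc 0 (1 / (8 * N)), ‖weylSum ⌊N⌋₊ θ‖ₑ ^ d) *
          ∑ u ∈ nbox d ⌊N⌋₊, ‖f (x - u)‖ₑ := lintegral_mul_const' _ _
        (ENNReal.sum_ne_top.2 fun _ _ => enorm_ne_top)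
      _ ≤ _ := mul_le_mul' (lintegral_weylSum_pow_le hd hn1 hn)
        (sum_nbox_le_maxHL hn1 (fun y => ‖f y‖ₑ) x)
  · rw [← lintegral_const_mul' _ _ (by finiteness)]
    refine setLIntegral_mono' ((measurableSet_minorArcs N).diff measurableSet_Icc) fun θ hθ => ?_
    refine mul_le_mul_left ?_ _
    have h1 := gramSum_le_of_mem_minorArcs hN hn hn' hθ.1 hθ.2
    have h2 : ‖weylSum ⌊N⌋₊ θ‖ ^ 2 ≤ 5152 * ((⌊N⌋₊ : ℝ) + 1) ^ (11 / 10 : ℝ) := by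
      linarith [norm_weylSum_sq_le ⌊N⌋₊ θ]
    have h3 := ENNReal.ofReal_le_ofReal h2
    rw [ENNReal.ofReal_pow (norm_nonneg _), ofReal_norm] at h3
    have h4 := ENNReal.rpow_le_rpow h3 (by positivity : (0 : ℝ) ≤ d / 2)
    rwa [← ENNReal.rpow_natCast, ← ENNReal.rpow_mul, Nat.cast_ofNat,
      mul_div_cancel₀ _ (two_ne_zero' ℝ), ENNReal.rpow_natCast] at h4

lemma rpow_lintegral_enorm_le {α : Type*} [MeasurableSpace α] {μ : Measure α} (hμ : μ Set.univ ≤ 1)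
    {f : α → ℂ} (hf : AEStronglyMeasurable f μ) {p : ℝ} (hp : 1 ≤ p) :
    (∫⁻ a, ‖f a‖ₑ ∂μ) ^ p ≤ ∫⁻ a, ‖f a‖ₑ ^ p ∂μ := by
  have hp0 : 0 < p := by linarith
  have h := eLpNorm'_le_eLpNorm'_mul_rpow_measure_univ one_pos hp hf
  have h1 : μ Set.univ ^ (1 / 1 - 1 / p) ≤ 1 := by
    refine ENNReal.rpow_le_one hμ ?_
    rw [div_one, sub_nonneg, div_le_one hp0]
    exact hp
  have h2 := h.trans (mul_le_of_le_one_right' h1)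
  simp only [eLpNorm', ENNReal.rpow_one, div_one] at h2
  rwa [one_div, ENNReal.le_rpow_inv_iff hp0] at h2

lemma tsum_rpow_lintegral_tailArcs_le (d : ℕ) {N : ℝ} (hN : 1 ≤ N) (f : V d → ℂ) {p : ℝ}
    (hp : 1 ≤ p) (hp2 : p ≤ 2) :
    ∑' x, (∫⁻ θ in tailArcs N, ‖weylOp d ⌊N⌋₊ θ f x‖ₑ) ^ p ≤
      2 ^ d * (((⌊N⌋₊ + 1 : ℝ≥0∞) ^ d) ^ (1 - p / 2) *
        (ENNReal.ofReal (2576 * ((⌊N⌋₊ : ℝ) + 1) ^ (11 / 10 : ℝ)) ^ d) ^ (p / 2)) *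
        ∑' y, ‖f y‖ₑ ^ p := by
  have hN0 : 0 ≤ N := by linarith
  have hvol : (volume.restrict (tailArcs N)) Set.univ ≤ 1 := by
    rw [Measure.restrict_apply_univ]
    have h : tailArcs N ⊆ Set.Icc 0 1 := fun θ hθ => hθ.1.1
    refine (measure_mono h).trans ?_
    simp
  calc _ ≤ ∑' x, ∫⁻ θ in tailArcs N, ‖weylOp d ⌊N⌋₊ θ f x‖ₑ ^ p :=
        ENNReal.tsum_le_tsum fun x => rpow_lintegral_enorm_le hvol
          (continuous_weylOp d _ f x).aestronglyMeasurable hp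
    _ = ∫⁻ θ in tailArcs N, ∑' x, ‖weylOp d ⌊N⌋₊ θ f x‖ₑ ^ p :=
        (lintegral_tsum fun x =>
          ((continuous_weylOp d _ f x).enorm.measurable.pow_const p).aemeasurable).symm
    _ ≤ ∫⁻ _ in tailArcs N, 2 ^ d * (((⌊N⌋₊ + 1 : ℝ≥0∞) ^ d) ^ (1 - p / 2) *
        (ENNReal.ofReal (2576 * ((⌊N⌋₊ : ℝ) + 1) ^ (11 / 10 : ℝ)) ^ d) ^ (p / 2)) *
        ∑' y, ‖f y‖ₑ ^ p := by
        refine setLIntegral_mono' ((measurableSet_minorArcs N).diff measurableSet_Icc)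
          fun θ hθ => ?_
        exact tsum_rpow_weylOp_le d _ θ f hp hp2 (gramSum_le_of_mem_minorArcs hN
          (Nat.floor_le hN0) (Nat.lt_floor_add_one N) hθ.1 hθ.2)
    _ ≤ _ := by
        rw [lintegral_const]
        exact mul_le_of_le_one_right' hvol

lemma tail_constant_eq (d : ℕ) (hd : 1 ≤ d) {c A : ℝ} (hc : 0 < c) (hA : 0 < A) (p : ℝ) :
    ((c * (A / 2) ^ (2 * (d - 1)))⁻¹ * (5152 * A ^ (11 / 10 : ℝ)) ^ (d / 2 : ℝ)) ^ p *
      (2 ^ d * ((A ^ d) ^ (1 - p / 2) * ((2576 * A ^ (11 / 10 : ℝ)) ^ d) ^ (p / 2))) =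
    (((c / 2 ^ (2 * (d - 1)))⁻¹ * 5152 ^ (d / 2 : ℝ)) ^ p * (2 ^ d * (2576 ^ d) ^ (p / 2))) *
      A ^ (p * (2 - 7 / 5 * d) + d) := by
  have e1 : (c * (A / 2) ^ (2 * (d - 1)))⁻¹ =
      (c / 2 ^ (2 * (d - 1)))⁻¹ * A ^ (-(2 * ((d : ℝ) - 1))) := by
    rw [Real.rpow_neg hA.le, show (2 * ((d : ℝ) - 1)) = ((2 * (d - 1) : ℕ) : ℝ) by
      push_cast [Nat.cast_sub hd]; ring, Real.rpow_natCast, div_pow]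
    field_simp
  have e2 : (5152 * A ^ (11 / 10 : ℝ)) ^ (d / 2 : ℝ) =
      5152 ^ (d / 2 : ℝ) * A ^ ((11 / 10 : ℝ) * (d / 2)) := by
    rw [Real.mul_rpow (by norm_num) (by positivity), Real.rpow_mul hA.le]
  have e3 : (A ^ d) ^ (1 - p / 2) = A ^ ((d : ℝ) * (1 - p / 2)) := by
    rw [Real.rpow_mul hA.le, Real.rpow_natCast]
  have e4 : ((2576 * A ^ (11 / 10 : ℝ)) ^ d) ^ (p / 2) =
      (2576 ^ d) ^ (p / 2) * A ^ ((11 / 10 : ℝ) * d * (p / 2)) := by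
    rw [mul_pow, Real.mul_rpow (by positivity) (by positivity), Real.rpow_mul hA.le,
      Real.rpow_mul hA.le, Real.rpow_natCast]
  have e5 : p * (2 - 7 / 5 * d) + d = (-(2 * ((d : ℝ) - 1)) + 11 / 10 * (d / 2)) * p +
      (d * (1 - p / 2) + 11 / 10 * d * (p / 2)) := by ring
  rw [e1, e2, e3, e4, e5, mul_mul_mul_comm, ← Real.rpow_add hA,
    Real.mul_rpow (by positivity) (by positivity), ← Real.rpow_mul hA.le,
    Real.rpow_add hA _ ((d : ℝ) * (1 - p / 2) + _), Real.rpow_add hA ((d : ℝ) * (1 - p / 2))]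
  ring

lemma rpow_exponent_le {d : ℕ} (hd : 3 ≤ d) {p A : ℝ} (hp : (d : ℝ) / ((d : ℝ) - 1) < p)
    (hp1 : 1 ≤ p) (j : ℕ) (hA : Real.sqrt (2 ^ j) ≤ A) :
    A ^ (p * (2 - 7 / 5 * d) + d) ≤ ((2 : ℝ) ^ (-(1 / 10) : ℝ)) ^ j := by
  have hd' : (3 : ℝ) ≤ d := by exact_mod_cast hd
  rw [div_lt_iff₀ (by linarith)] at hp
  have hN1 : 1 ≤ Real.sqrt (2 ^ j) := Real.one_le_sqrt.2 (one_le_pow₀ one_le_two)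
  calc A ^ (p * (2 - 7 / 5 * d) + d) ≤ A ^ (-(1 / 5) : ℝ) :=
        Real.rpow_le_rpow_of_exponent_le (hN1.trans hA) (by nlinarith)
    _ ≤ Real.sqrt (2 ^ j) ^ (-(1 / 5) : ℝ) :=
        Real.rpow_le_rpow_of_nonpos (by linarith) hA (by norm_num)
    _ = _ := by
        rw [Real.sqrt_eq_rpow, ← Real.rpow_natCast, ← Real.rpow_natCast,
          ← Real.rpow_mul (by norm_num), ← Real.rpow_mul (by norm_num),
          ← Real.rpow_mul (by norm_num)]
        congr 1
        ring

/-- The part of the maximal operator at scale `2 ^ j` coming from the tail of the minor arcs. -/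
def tailOp (d : ℕ) (c : ℝ) (j : ℕ) (f : V d → ℂ) (x : V d) : ℝ≥0∞ :=
  ENNReal.ofReal ((c * (((⌊Real.sqrt (2 ^ j)⌋₊ : ℝ) + 1) / 2) ^ (2 * (d - 1)))⁻¹ *
    (5152 * ((⌊Real.sqrt (2 ^ j)⌋₊ : ℝ) + 1) ^ (11 / 10 : ℝ)) ^ (d / 2 : ℝ)) *
    ∫⁻ θ in tailArcs (Real.sqrt (2 ^ j)), ‖weylOp d ⌊Real.sqrt (2 ^ j)⌋₊ θ f x‖ₑ

lemma one_le_sqrt_two_pow (j : ℕ) : 1 ≤ Real.sqrt (2 ^ j) :=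
  Real.one_le_sqrt.2 (one_le_pow₀ one_le_two)

lemma exists_tsum_tailOp_le {d : ℕ} (hd : 3 ≤ d) {p : ℝ} (hp : (d : ℝ) / ((d : ℝ) - 1) < p)
    (hp1 : 1 ≤ p) (hp2 : p ≤ 2) {c : ℝ} (hc : 0 < c) :
    ∃ C : ℝ≥0, ∀ f : V d → ℂ, ∑' x, ∑' j, tailOp d c j f x ^ p ≤ C * ∑' y, ‖f y‖ₑ ^ p := by
  set K : ℝ := ((c / 2 ^ (2 * (d - 1)))⁻¹ * 5152 ^ (d / 2 : ℝ)) ^ p *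
    (2 ^ d * (2576 ^ d) ^ (p / 2)) with hK
  have hK0 : 0 ≤ K := by positivity
  set ρ : ℝ := (2 : ℝ) ^ (-(1 / 10) : ℝ) with hρ
  have hρ0 : 0 ≤ ρ := by positivity
  have hρ1 : ρ < 1 := Real.rpow_lt_one_of_one_lt_of_neg one_lt_two (by norm_num)
  have hp0 : 0 ≤ p := by linarith
  have key : ∀ (f : V d → ℂ) (j : ℕ), ∑' x, tailOp d c j f x ^ p ≤
      ENNReal.ofReal K * ENNReal.ofReal ρ ^ j * ∑' y, ‖f y‖ₑ ^ p := by
    intro f j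
    set N := Real.sqrt (2 ^ j) with hN
    set A : ℝ := (⌊N⌋₊ : ℝ) + 1 with hA
    have hA0 : 0 < A := by positivity
    have hNA : N ≤ A := (Nat.lt_floor_add_one N).le
    have h1 := tsum_rpow_lintegral_tailArcs_le d (one_le_sqrt_two_pow j) f hp1 hp2
    rw [← hN, ← hA] at h1
    have hAE : (⌊N⌋₊ + 1 : ℝ≥0∞) = ENNReal.ofReal A := by
      rw [hA, ENNReal.ofReal_add (by positivity) zero_le_one, ENNReal.ofReal_natCast,
        ENNReal.ofReal_one]
    have hconst : (2 : ℝ≥0∞) ^ d * (((⌊N⌋₊ + 1 : ℝ≥0∞) ^ d) ^ (1 - p / 2) *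
        (ENNReal.ofReal (2576 * A ^ (11 / 10 : ℝ)) ^ d) ^ (p / 2)) =
        ENNReal.ofReal (2 ^ d * ((A ^ d) ^ (1 - p / 2) *
          ((2576 * A ^ (11 / 10 : ℝ)) ^ d) ^ (p / 2))) := by
      rw [hAE, ← ENNReal.ofReal_pow hA0.le, ← ENNReal.ofReal_pow (by positivity),
        ENNReal.ofReal_rpow_of_nonneg (by positivity) (by linarith),
        ENNReal.ofReal_rpow_of_nonneg (by positivity) (by linarith),
        ← ENNReal.ofReal_mul (by positivity), ENNReal.ofReal_mul (p := 2 ^ d) (by positivity),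
        ENNReal.ofReal_pow zero_le_two, ENNReal.ofReal_ofNat]
    rw [hconst] at h1
    simp only [tailOp, ← hN, ← hA, ENNReal.mul_rpow_of_nonneg _ _ hp0]
    rw [ENNReal.tsum_mul_left, ENNReal.ofReal_rpow_of_nonneg (by positivity) hp0]
    refine (mul_le_mul_right h1 _).trans ?_
    rw [← mul_assoc, ← ENNReal.ofReal_mul (by positivity),
      tail_constant_eq d (by omega) hc hA0 p, ← hK, ← ENNReal.ofReal_pow hρ0,
      ← ENNReal.ofReal_mul hK0]
    gcongr
    exact rpow_exponent_le hd hp hp1 j hNA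
  have hfin : ENNReal.ofReal K * (1 - ENNReal.ofReal ρ)⁻¹ ≠ ⊤ := by
    refine ENNReal.mul_ne_top ENNReal.ofReal_ne_top (ENNReal.inv_ne_top.2 ?_)
    exact (tsub_pos_of_lt (by rwa [← ENNReal.ofReal_one, ENNReal.ofReal_lt_ofReal_iff one_pos])).ne'
  refine ⟨(ENNReal.ofReal K * (1 - ENNReal.ofReal ρ)⁻¹).toNNReal, fun f => ?_⟩
  rw [ENNReal.coe_toNNReal hfin, ENNReal.tsum_comm]
  refine (ENNReal.tsum_le_tsum fun j => key f j).trans (le_of_eq ?_)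
  rw [ENNReal.tsum_mul_right, ENNReal.tsum_mul_left, ENNReal.tsum_geometric]

lemma inv_Ncount_le {d : ℕ} {c : ℝ} (hc : 0 < c)
    (h : ∀ lam : ℕ, c * (lam : ℝ) ^ (d - 1) ≤ Ncount d lam) {lam : ℕ} (hlam : 1 ≤ lam) :
    (Ncount d lam : ℝ≥0∞)⁻¹ ≤ ENNReal.ofReal
      (c * (((⌊Real.sqrt (2 ^ Nat.log 2 lam)⌋₊ : ℝ) + 1) / 2) ^ (2 * (d - 1)))⁻¹ := by
  set N := Real.sqrt (2 ^ Nat.log 2 lam) with hN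
  have hN1 : 1 ≤ N := one_le_sqrt_two_pow _
  have hfl : (⌊N⌋₊ : ℝ) ≤ N := Nat.floor_le (by linarith)
  have h2 : (2 : ℝ) ^ Nat.log 2 lam ≤ lam := by
    exact_mod_cast Nat.pow_log_le_self 2 (by omega : lam ≠ 0)
  have h3 : N ^ 2 = 2 ^ Nat.log 2 lam := Real.sq_sqrt (by positivity)
  rw [ENNReal.ofReal_inv_of_pos (by positivity), ← ENNReal.ofReal_natCast]
  refine ENNReal.inv_le_inv.2 (ENNReal.ofReal_le_ofReal ?_)
  refine le_trans ?_ (h lam)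
  rw [pow_mul]
  gcongr
  have h4 : (((⌊N⌋₊ : ℝ) + 1) / 2) ^ 2 ≤ N ^ 2 := by gcongr; linarith
  exact h4.trans (h3.trans_le h2)

lemma exists_enorm_Efull_le {d : ℕ} (hd : 3 ≤ d) : ∃ (C : ℝ≥0) (c : ℝ), 0 < c ∧
    ∀ (f : V d → ℂ) (x : V d) (lam : ℕ), 1 ≤ lam →
      ‖Efull d lam f x‖ₑ ≤ C * maxHL (fun y => ‖f y‖ₑ) x + tailOp d c (Nat.log 2 lam) f x := by
  obtain ⟨c, hc, h⟩ := exists_Ncount_ge hd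
  set K : ℝ := (c / 2 ^ (2 * (d - 1)))⁻¹ * 2593 * 2 ^ d with hK
  have hK0 : 0 ≤ K := by positivity
  refine ⟨K.toNNReal, c, hc, fun f x lam hlam => ?_⟩
  have hN1 := one_le_sqrt_two_pow (Nat.log 2 lam)
  refine (enorm_Eminor_le_add hd lam hN1 f x).trans ?_
  refine (mul_le_mul_left (inv_Ncount_le hc h hlam) _).trans ?_
  set N := Real.sqrt (2 ^ Nat.log 2 lam) with hN
  set A : ℝ := (⌊N⌋₊ : ℝ) + 1 with hA
  have hA0 : 0 < A := by positivity
  rw [mul_add]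
  refine add_le_add ?_ ?_
  · have hAE : (2 * (⌊N⌋₊ + 1) : ℝ≥0∞) = ENNReal.ofReal (2 * A) := by
      rw [hA, ENNReal.ofReal_mul zero_le_two, ENNReal.ofReal_add (by positivity) zero_le_one,
        ENNReal.ofReal_natCast, ENNReal.ofReal_one, ENNReal.ofReal_ofNat]
    rw [hAE, ← ENNReal.ofReal_pow (by positivity), ← mul_assoc, ← mul_assoc,
      ← ENNReal.ofReal_mul (by positivity), ← ENNReal.ofReal_mul (by positivity)]
    refine mul_le_mul_left (ENNReal.ofReal_le_ofReal (le_of_eq ?_)) _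
    obtain ⟨k, rfl⟩ := Nat.exists_eq_add_of_le (show 2 ≤ d by omega)
    rw [hK, show 2 + k - 2 = k by omega, show 2 * (2 + k - 1) = 2 * k + 2 by omega, div_pow]
    field_simp
    ring_nf
  · rw [tailOp, ← hN, ← hA, ← mul_assoc, ENNReal.ofReal_rpow_of_nonneg (by positivity)
      (by positivity), ← ENNReal.ofReal_mul (by positivity)]

end MinorArc

/-- For `d ≥ 3` and `d/(d-1) < p ≤ 2`, the full minor-arc maximal operator
`sup_{λ ≥ 1} |E_{m,λ} f|` is bounded on `l^p(ℤ^d)`. -/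
theorem minor_arc_full_maximal_lp (d : ℕ) (hd : 3 ≤ d)
    (p : ℝ) (hp : (d : ℝ) / ((d : ℝ) - 1) < p) (hp2 : p ≤ 2) :
    ∃ C : ℝ≥0, ∀ f : V d → ℂ,
      lpNormE d p
        (fun x => ⨆ (lam : ℕ) (_ : 1 ≤ lam), (‖Efull d lam f x‖₊ : ℝ≥0∞)) ≤
      C * lpNorm d p f := by
  have hd' : (3 : ℝ) ≤ d := by exact_mod_cast hd
  have hp1 : 1 < p := by
    refine lt_trans ?_ hp
    rw [one_lt_div (by linarith)]
    linarith
  have hp0 : 0 < p := by linarith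
  obtain ⟨C₁, c, hc, h₁⟩ := MinorArc.exists_enorm_Efull_le hd
  obtain ⟨C₂, h₂⟩ := MinorArc.exists_tsum_maxHL_rpow_le d hp1
  obtain ⟨C₃, h₃⟩ := MinorArc.exists_tsum_tailOp_le hd hp hp1.le hp2 hc
  have hfin : ((2 : ℝ≥0∞) ^ (p - 1) * (C₁ ^ p * C₂ + C₃)) ^ (1 / p) ≠ ⊤ := by
    have : 0 ≤ p - 1 := by linarith
    finiteness
  refine ⟨(((2 : ℝ≥0∞) ^ (p - 1) * (C₁ ^ p * C₂ + C₃)) ^ (1 / p)).toNNReal, fun f => ?_⟩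
  change (∑' x, (⨆ (lam : ℕ) (_ : 1 ≤ lam), (‖Efull d lam f x‖₊ : ℝ≥0∞)) ^ p) ^ (1 / p) ≤
    _ * (∑' x, ‖f x‖ₑ ^ p) ^ (1 / p)
  rw [ENNReal.coe_toNNReal hfin,
    ← ENNReal.mul_rpow_of_nonneg _ _ (by positivity : 0 ≤ 1 / p)]
  refine ENNReal.rpow_le_rpow ?_ (by positivity)
  have hpt : ∀ x, (⨆ (lam : ℕ) (_ : 1 ≤ lam), (‖Efull d lam f x‖₊ : ℝ≥0∞)) ≤
      C₁ * MinorArc.maxHL (fun y => ‖f y‖ₑ) x +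
        (∑' j, MinorArc.tailOp d c j f x ^ p) ^ (1 / p) := by
    refine fun x => iSup₂_le fun lam hlam => (h₁ f x lam hlam).trans (add_le_add_right ?_ _)
    rw [one_div, ENNReal.le_rpow_inv_iff hp0]
    exact ENNReal.le_tsum (f := fun j => MinorArc.tailOp d c j f x ^ p) _
  calc _ ≤ ∑' x, 2 ^ (p - 1) * (C₁ ^ p * MinorArc.maxHL (fun y => ‖f y‖ₑ) x ^ p +
        ∑' j, MinorArc.tailOp d c j f x ^ p) := by
        refine ENNReal.tsum_le_tsum fun x => (ENNReal.rpow_le_rpow (hpt x) hp0.le).trans ?_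
        refine (ENNReal.rpow_add_le_mul_rpow_add_rpow _ _ hp1.le).trans (le_of_eq ?_)
        rw [ENNReal.mul_rpow_of_nonneg _ _ hp0.le, ← ENNReal.rpow_mul,
          one_div_mul_cancel hp0.ne', ENNReal.rpow_one]
    _ = 2 ^ (p - 1) * (C₁ ^ p * ∑' x, MinorArc.maxHL (fun y => ‖f y‖ₑ) x ^ p +
        ∑' x, ∑' j, MinorArc.tailOp d c j f x ^ p) := by
        rw [ENNReal.tsum_mul_left, ENNReal.tsum_add, ENNReal.tsum_mul_left]
    _ ≤ 2 ^ (p - 1) * (C₁ ^ p * (C₂ * ∑' y, ‖f y‖ₑ ^ p) + C₃ * ∑' y, ‖f y‖ₑ ^ p) := by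
        gcongr
        · exact h₂ _ fun _ => enorm_ne_top
        · exact h₃ f
    _ = 2 ^ (p - 1) * (C₁ ^ p * C₂ + C₃) * ∑' y, ‖f y‖ₑ ^ p := by ring
end
end

section
/- Let d ≥ 3 be an integer and let 1 ≤ p < ∞. If there exists a constant C such that ‖T*(f,g)‖_{l^p(ℤ^d)} ≤ C ‖f‖_{l^p(ℤ^d)} ‖g‖_{l^∞(ℤ^d)} for all f ∈ l^p(ℤ^d) and g ∈ l^∞(ℤ^d), then p > 1. -/
open scoped ENNReal NNReal BigOperators

noncomputable section

/-- The bilinear discrete spherical average `T_λ(f,g)(x)`. -/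
def avg (d lam : ℕ) (f g : V d → ℂ) (x : V d) : ℂ :=
  (Ncount d lam : ℂ)⁻¹ *
    ∑' uv : sph d lam, f (x - (uv : V d × V d).1) * g (x - (uv : V d × V d).2)

/-- The bilinear discrete spherical maximal function
`T*(f,g)(x) = sup_{λ ∈ ℕ, N(λ) > 0} |T_λ(f,g)(x)|`. -/
def maxOp (d : ℕ) (f g : V d → ℂ) (x : V d) : ℝ≥0∞ :=
  ⨆ (lam : ℕ) (_ : 0 < Ncount d lam), (‖avg d lam f g x‖₊ : ℝ≥0∞)

/-- The `l^∞(ℤ^d)` norm. -/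
def linftyNorm (d : ℕ) (f : V d → ℂ) : ℝ≥0∞ :=
  ⨆ x : V d, (‖f x‖₊ : ℝ≥0∞)


/-- The cube `{-n, …, n}^d`. -/
def cube (d n : ℕ) : Finset (V d) := Fintype.piFinset fun _ => Finset.Icc (-(n : ℤ)) n

lemma mem_cube {d n : ℕ} {x : V d} : x ∈ cube d n ↔ ∀ i, |x i| ≤ n := by
  simp [cube, Fintype.mem_piFinset, abs_le]

lemma card_cube (d n : ℕ) : (cube d n).card = (2 * n + 1) ^ d := by
  simp only [cube, Fintype.card_piFinset, Int.card_Icc, Finset.prod_const, Finset.card_univ,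
    Fintype.card_fin]
  congr 1
  lia

/-- The quadratic form `|u|² + |v|²` with natural number values. -/
def sqNorm {d : ℕ} (uv : V d × V d) : ℕ := ((∑ i, uv.1 i ^ 2) + (∑ i, uv.2 i ^ 2)).toNat

lemma coe_sqNorm {d : ℕ} (uv : V d × V d) :
    (sqNorm uv : ℤ) = (∑ i, uv.1 i ^ 2) + (∑ i, uv.2 i ^ 2) :=
  Int.toNat_of_nonneg (by positivity)

lemma mem_sph_iff {d lam : ℕ} {uv : V d × V d} : uv ∈ sph d lam ↔ sqNorm uv = lam := by
  rw [← Nat.cast_inj (R := ℤ), coe_sqNorm]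
  rfl

lemma mem_cube_of_sum_sq_le {d n : ℕ} {x : V d} (h : ∑ i, x i ^ 2 ≤ (n : ℤ) ^ 2) :
    x ∈ cube d n := by
  refine mem_cube.2 fun i => abs_le_of_sq_le_sq ?_ (by positivity)
  exact (Finset.single_le_sum (fun j _ => sq_nonneg (x j)) (Finset.mem_univ i)).trans h

lemma sum_sq_le_of_mem_cube {d n : ℕ} {x : V d} (h : x ∈ cube d n) :
    ∑ i, x i ^ 2 ≤ (d : ℤ) * n ^ 2 := by
  calc ∑ i, x i ^ 2 ≤ ∑ _i : Fin d, (n : ℤ) ^ 2 :=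
        Finset.sum_le_sum fun i _ => sq_le_sq.2 (by simpa using mem_cube.1 h i)
    _ = _ := by simp

lemma sph_eq_coe_filter {d lam n : ℕ} (h : lam ≤ n ^ 2) :
    sph d lam = ((cube d n ×ˢ cube d n).filter fun uv => sqNorm uv = lam : Finset (V d × V d)) := by
  ext uv
  simp only [mem_sph_iff, Finset.coe_filter, Finset.mem_product, Set.mem_ofPred_eq]
  refine ⟨fun huv => ⟨?_, huv⟩, fun huv => huv.2⟩
  have h1 := coe_sqNorm uv
  have h2 : (lam : ℤ) ≤ (n : ℤ) ^ 2 := mod_cast h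
  have h3 : 0 ≤ ∑ i, uv.1 i ^ 2 := by positivity
  have h4 : 0 ≤ ∑ i, uv.2 i ^ 2 := by positivity
  rw [huv] at h1
  exact ⟨mem_cube_of_sum_sq_le (by linarith), mem_cube_of_sum_sq_le (by linarith)⟩

lemma Ncount_eq_card {d lam n : ℕ} (h : lam ≤ n ^ 2) :
    Ncount d lam = ((cube d n ×ˢ cube d n).filter fun uv => sqNorm uv = lam).card := by
  rw [Ncount, sph_eq_coe_filter h, Nat.card_coe_set_eq, Set.ncard_coe_finset]

/-- The average of the pair `(δ₀, 1)` counts the points of the sphere in the fibre over `x`. -/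
lemma avg_single_one {d lam n : ℕ} (h : lam ≤ n ^ 2) (x : V d) :
    avg d lam (Pi.single 0 1) 1 x = (Ncount d lam : ℂ)⁻¹ *
      (((cube d n ×ˢ cube d n).filter fun uv => sqNorm uv = lam).filter
        fun uv => uv.1 = x).card := by
  rw [avg, sph_eq_coe_filter h]
  congr 1
  rw [Finset.tsum_subtype' _ fun uv : V d × V d =>
    (Pi.single 0 1 : V d → ℂ) (x - uv.1) * (1 : V d → ℂ) (x - uv.2)]
  simp [Pi.single_apply, sub_eq_zero, eq_comm]

/-- If the maximal function of `(δ₀, 1)` at `x` is at most `t`, so is the ratio of fibre to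
sphere cardinalities for each radius. -/
lemma card_fibre_le {d lam n : ℕ} (h : lam ≤ n ^ 2) {x : V d} {t : ℝ≥0}
    (ht : maxOp d (Pi.single 0 1) 1 x ≤ t) :
    ((((cube d n ×ˢ cube d n).filter fun uv => sqNorm uv = lam).filter
        fun uv => uv.1 = x).card : ℝ≥0) ≤ t * Ncount d lam := by
  rcases Nat.eq_zero_or_pos (Ncount d lam) with h0 | hpos
  · have := h0
    rw [Ncount_eq_card h, Finset.card_eq_zero] at this
    simp [this]
  · have h1 := (le_iSup₂ (f := fun (l : ℕ) (_ : 0 < Ncount d l) =>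
      (‖avg d l (Pi.single 0 1) 1 x‖₊ : ℝ≥0∞)) lam hpos).trans ht
    rw [ENNReal.coe_le_coe, avg_single_one h, nnnorm_mul, nnnorm_inv, Complex.nnnorm_natCast,
      Complex.nnnorm_natCast, inv_mul_le_iff₀ (by exact_mod_cast hpos)] at h1
    rwa [mul_comm]

lemma one_le_mul_of_maxOp_le {d R : ℕ} {x : V d} (hx : x ∈ cube d R) {t : ℝ≥0}
    (ht : maxOp d (Pi.single 0 1) 1 x ≤ t) :
    ((2 * R + 1) ^ d : ℝ≥0) ≤ t * ((2 * (2 * d * R) + 1) ^ d * (2 * (2 * d * R) + 1) ^ d) := by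
  set n := 2 * d * R with hn
  set L := Finset.range (2 * d * R ^ 2 + 1) with hL
  have hlam : ∀ lam ∈ L, lam ≤ n ^ 2 := by
    intro lam hl
    have h1 : lam ≤ 2 * d * R ^ 2 := by simpa [hL, Nat.lt_succ_iff] using hl
    have h2 : 2 * d ≤ (2 * d) ^ 2 := Nat.le_self_pow two_ne_zero _
    calc lam ≤ 2 * d * R ^ 2 := h1
      _ ≤ (2 * d) ^ 2 * R ^ 2 := Nat.mul_le_mul_right _ h2
      _ = n ^ 2 := by rw [hn]; ring
  have hmaps : ∀ v ∈ cube d R, sqNorm (x, v) ∈ L := by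
    intro v hv
    have h1 := coe_sqNorm (x, v)
    have h2 := sum_sq_le_of_mem_cube hx
    have h3 := sum_sq_le_of_mem_cube hv
    have h4 : (sqNorm (x, v) : ℤ) ≤ ((2 * d * R ^ 2 : ℕ) : ℤ) := by
      push_cast; simp only at h1; linarith
    rw [hL, Finset.mem_range, Nat.lt_succ_iff]
    exact_mod_cast h4
  have hlower : (2 * R + 1) ^ d ≤ ∑ lam ∈ L,
      (((cube d n ×ˢ cube d n).filter fun uv => sqNorm uv = lam).filter
        fun uv => uv.1 = x).card := by
    rw [← card_cube, Finset.card_eq_sum_card_fiberwise hmaps]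
    refine Finset.sum_le_sum fun lam hl => ?_
    refine Finset.card_le_card_of_injOn (fun v => (x, v)) ?_ ?_
    · intro v hv
      have hv2 : sqNorm (x, v) = lam := (Finset.mem_filter.1 hv).2
      have : (x, v) ∈ sph d lam := mem_sph_iff.2 hv2
      rw [sph_eq_coe_filter (hlam lam hl)] at this
      simpa using this
    · intro v _ w _ hvw
      exact (Prod.ext_iff.1 hvw).2
  have hupper : ∑ lam ∈ L, Ncount d lam ≤ (2 * n + 1) ^ d * (2 * n + 1) ^ d := by
    rw [Finset.sum_congr rfl fun lam hl => Ncount_eq_card (hlam lam hl),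
      Finset.sum_card_fiberwise_eq_card_filter, ← card_cube, ← Finset.card_product]
    exact Finset.card_filter_le _ _
  calc ((2 * R + 1) ^ d : ℝ≥0) ≤ ((∑ lam ∈ L,
      (((cube d n ×ˢ cube d n).filter fun uv => sqNorm uv = lam).filter
        fun uv => uv.1 = x).card : ℕ) : ℝ≥0) := by exact_mod_cast hlower
    _ ≤ ∑ lam ∈ L, t * Ncount d lam := by
        rw [Nat.cast_sum]
        exact Finset.sum_le_sum fun lam hl => card_fibre_le (hlam lam hl) ht
    _ = t * ((∑ lam ∈ L, Ncount d lam : ℕ) : ℝ≥0) := by rw [← Finset.mul_sum, Nat.cast_sum]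
    _ ≤ t * ((2 * n + 1) ^ d * (2 * n + 1) ^ d) := by
        gcongr
        exact_mod_cast hupper
    _ = _ := by rw [hn]; push_cast; ring

/-- On the cube of side `2R + 1` the maximal function of `(δ₀, 1)` is `≳ (2R + 1)^{-d}`. -/
lemma inv_le_maxOp {d : ℕ} (hd : 0 < d) {R : ℕ} {x : V d} (hx : x ∈ cube d R) :
    (((((2 * d) ^ d * (2 * d) ^ d) * (2 * R + 1) ^ d : ℝ≥0)⁻¹ : ℝ≥0) : ℝ≥0∞) ≤
      maxOp d (Pi.single 0 1) 1 x := by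
  rcases eq_or_ne (maxOp d (Pi.single 0 1) 1 x) ∞ with htop | htop
  · rw [htop]; exact le_top
  lift maxOp d (Pi.single 0 1) 1 x to ℝ≥0 using htop with t ht
  have h := one_le_mul_of_maxOp_le hx ht.ge
  rw [ENNReal.coe_le_coe]
  have hd1 : (1 : ℝ≥0) ≤ 2 * d := by
    have : 1 ≤ 2 * d := by lia
    exact_mod_cast this
  have h1 : (2 * (2 * d * R) + 1 : ℝ≥0) ≤ 2 * d * (2 * R + 1) := by
    calc (2 * (2 * d * R) + 1 : ℝ≥0) ≤ 2 * (2 * d * R) + 2 * d := by gcongr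
      _ = _ := by ring
  have hA : (0 : ℝ≥0) < (2 * R + 1) ^ d := by positivity
  have h2 : ((2 * R + 1) ^ d : ℝ≥0) ≤
      (t * (((2 * d) ^ d * (2 * d) ^ d) * (2 * R + 1) ^ d)) * (2 * R + 1) ^ d := by
    calc ((2 * R + 1) ^ d : ℝ≥0)
        ≤ t * ((2 * (2 * d * R) + 1) ^ d * (2 * (2 * d * R) + 1) ^ d) := h
      _ ≤ t * ((2 * d * (2 * R + 1)) ^ d * (2 * d * (2 * R + 1)) ^ d) := by gcongr
      _ = _ := by rw [mul_pow (2 * (d : ℝ≥0))]; ring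
  have h3 := (le_mul_iff_one_le_left hA).1 h2
  have hd0 : (0 : ℝ≥0) < 2 * d := zero_lt_one.trans_le hd1
  rw [inv_le_iff_one_le_mul₀ (by positivity)]
  exact h3

/-- A function on `ℤ^d` that is `≳ (2R + 1)^{-d}` on every cube is not summable. -/
lemma tsum_eq_top_of_inv_le {d : ℕ} (hd : 0 < d) {c : ℝ≥0} (hc : 0 < c) {F : V d → ℝ≥0∞}
    (hF : ∀ R : ℕ, ∀ x ∈ cube d R, (((c * (2 * R + 1) ^ d)⁻¹ : ℝ≥0) : ℝ≥0∞) ≤ F x) :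
    ∑' x, F x = ∞ := by
  by_contra htop
  have hε : (0 : ℝ≥0∞) < (((2 * c)⁻¹ : ℝ≥0) : ℝ≥0∞) := by
    rw [ENNReal.coe_pos]; positivity
  obtain ⟨S, hS⟩ := ((ENNReal.tendsto_tsum_compl_atTop_zero htop).eventually_lt_const hε).exists
  set R := S.card with hR
  set m : ℕ := (2 * R + 1) ^ d with hm
  have hmS : 2 * S.card ≤ m := by
    have : 2 * R + 1 ≤ (2 * R + 1) ^ d := Nat.le_self_pow hd.ne' _
    lia
  have hcard : m ≤ 2 * (cube d R \ S).card := by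
    have := Finset.le_card_sdiff S (cube d R)
    rw [card_cube] at this
    lia
  have hsum : ((((2 * c)⁻¹ : ℝ≥0)) : ℝ≥0∞) ≤ ∑ x ∈ cube d R \ S, F x := by
    calc ((((2 * c)⁻¹ : ℝ≥0)) : ℝ≥0∞)
        ≤ (((cube d R \ S).card * (c * m)⁻¹ : ℝ≥0) : ℝ≥0∞) := by
          rw [ENNReal.coe_le_coe]
          have hm0 : (0 : ℝ≥0) < m := by rw [hm]; positivity
          have h' : (m : ℝ≥0) ≤ 2 * (cube d R \ S).card := by exact_mod_cast hcard
          rw [← div_eq_mul_inv, le_div_iff₀ (by positivity), inv_mul_le_iff₀ (by positivity)]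
          calc c * m ≤ c * (2 * (cube d R \ S).card) := by gcongr
            _ = _ := by ring
      _ = ∑ _x ∈ cube d R \ S, (((c * (2 * R + 1) ^ d)⁻¹ : ℝ≥0) : ℝ≥0∞) := by
          rw [Finset.sum_const, nsmul_eq_mul, ENNReal.coe_mul, hm]
          push_cast
          rfl
      _ ≤ _ := Finset.sum_le_sum fun x hx => hF R x (Finset.mem_sdiff.1 hx).1
  have htail : ∑ x ∈ cube d R \ S, F x ≤ ∑' x : {x // x ∉ S}, F x := by
    rw [← Finset.tsum_subtype]
    exact ENNReal.tsum_mono_subtype F fun x hx => (Finset.mem_sdiff.1 hx).2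
  exact absurd (hsum.trans htail) hS.not_ge

/-- For `d ≥ 3`, if the bilinear discrete spherical maximal operator is
bounded from `l^p(ℤ^d) × l^∞(ℤ^d)` to `l^p(ℤ^d)` with `1 ≤ p < ∞`, then necessarily `p > 1`. -/
theorem bilinear_discrete_spherical_necessary_p_gt_one
    (d : ℕ) (hd : 3 ≤ d) (p : ℝ) (hp : 1 ≤ p)
    (hbound : ∃ C : ℝ≥0, ∀ f g : V d → ℂ,
      lpNormE d p (maxOp d f g) ≤ C * lpNorm d p f * linftyNorm d g) :
    1 < p := by
  refine hp.lt_of_ne fun hp1 => ?_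
  subst hp1
  obtain ⟨C, hC⟩ := hbound
  have hd0 : 0 < d := by lia
  have h := hC (Pi.single 0 1) 1
  have hleft : lpNormE d 1 (maxOp d (Pi.single 0 1) 1) = ∞ := by
    simp only [lpNormE, ENNReal.rpow_one, div_one]
    exact tsum_eq_top_of_inv_le hd0 (c := (2 * d) ^ d * (2 * d) ^ d) (by positivity)
      fun R x hx => inv_le_maxOp hd0 hx
  have hf : lpNorm d 1 (Pi.single 0 1) = 1 := by
    simp only [lpNorm, ENNReal.rpow_one, div_one]
    rw [tsum_eq_single 0 fun x hx => by simp [hx]]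
    simp
  have hg : linftyNorm d 1 = 1 := by simp [linftyNorm]
  rw [hleft, hf, hg, mul_one, mul_one, top_le_iff] at h
  exact ENNReal.coe_ne_top h
end
end
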